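/- arXiv:2005.12851 — 2 statements merged into one kernel-verified Lean document; each statement's English description precedes it below -/
import Mathlib

section
/- There exists a constant T* with c·T* > √3·π such that for every period T with 0 < T ≤ T* and every continuous T-periodic p₀ : ℝ → ℝ with zero average over [0, T], one has 0 ∈ I(p₀); moreover, if T < T*, then 0 is an interior point of I(p₀). -/
open Real Set MeasureTheory

/-- The relativistic operator `φ(v) = v / √(1 - v²/c²)`. -/
noncomputable def phi (c v : ℝ) : ℝ := v / Real.sqrt (1 - v ^ 2 / c ^ 2)

/-- `x` is a `T`-periodic solution of the relativistic pendulum equation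
`(φ(x'))' + a x' + b sin x = p`. -/
def IsPendSol (c a b T : ℝ) (p x : ℝ → ℝ) : Prop :=
  Function.Periodic x T ∧
  ContDiff ℝ 1 x ∧
  (∀ t : ℝ, |deriv x t| < c) ∧
  ContDiff ℝ 1 (fun t : ℝ => phi c (deriv x t)) ∧
  ∀ t : ℝ, deriv (fun τ : ℝ => phi c (deriv x τ)) t + a * deriv x t + b * Real.sin (x t) = p t

/-- The solvability set `I(p₀)`: the values `s` for which the relativistic pendulum
equation with forcing `p₀ + s` has a `T`-periodic solution. -/
def solvSet (c a b T : ℝ) (p₀ : ℝ → ℝ) : Set ℝ :=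
  {s : ℝ | ∃ x : ℝ → ℝ, IsPendSol c a b T (fun t => p₀ t + s) x}

noncomputable def psi (c w : ℝ) : ℝ := c * Real.sin (Real.arctan (w / c))

lemma psi_cont (c : ℝ) : Continuous (psi c) := by
  unfold psi; fun_prop

lemma psi_abs_lt {c : ℝ} (hc : 0 < c) (w : ℝ) : |psi c w| < c := by
  have h1 := Real.neg_pi_div_two_lt_arctan (w / c)
  have h2 := Real.arctan_lt_pi_div_two (w / c)
  have hcos := Real.cos_pos_of_mem_Ioo ⟨h1, h2⟩
  have hs : |Real.sin (Real.arctan (w / c))| < 1 := by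
    rw [← sq_lt_one_iff_abs_lt_one]
    nlinarith [Real.sin_sq_add_cos_sq (Real.arctan (w / c))]
  unfold psi
  rw [abs_mul, abs_of_pos hc]
  nlinarith

lemma psi_mono {c : ℝ} (hc : 0 < c) : StrictMono (psi c) := by
  intro x y h
  unfold psi
  have : x / c < y / c := by gcongr
  have := Real.sin_arctan_strictMono this
  simp only at this
  nlinarith

lemma psi_pos {c : ℝ} (hc : 0 < c) {w : ℝ} (hw : 0 < w) : 0 < psi c w := by
  have := psi_mono hc hw
  simpa [psi] using this

lemma psi_neg {c : ℝ} (hc : 0 < c) {w : ℝ} (hw : w < 0) : psi c w < 0 := by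
  have := psi_mono hc hw
  simpa [psi] using this

lemma phi_psi {c : ℝ} (hc : 0 < c) (w : ℝ) : phi c (psi c w) = w := by
  have h1 := Real.neg_pi_div_two_lt_arctan (w / c)
  have h2 := Real.arctan_lt_pi_div_two (w / c)
  have hcos := Real.cos_pos_of_mem_Ioo ⟨h1, h2⟩
  unfold phi psi
  have : 1 - (c * Real.sin (Real.arctan (w / c))) ^ 2 / c ^ 2 = Real.cos (Real.arctan (w / c)) ^ 2 := by
    rw [Real.cos_sq']; field_simp
  rw [this, Real.sqrt_sq hcos.le, mul_div_assoc, ← Real.tan_eq_sin_div_cos, Real.tan_arctan]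
  field_simp

lemma arctan_lip : LipschitzWith 1 Real.arctan := by
  apply lipschitzWith_of_nnnorm_deriv_le Real.differentiable_arctan
  intro x
  rw [Real.deriv_arctan]
  rw [← NNReal.coe_le_coe]
  simp only [coe_nnnorm, Real.norm_eq_abs, NNReal.coe_one]
  rw [abs_of_pos (by positivity), div_le_one (by positivity)]
  nlinarith

lemma arctan_sub_le (x y : ℝ) : |Real.arctan x - Real.arctan y| ≤ |x - y| := by
  have := arctan_lip.dist_le_mul x y
  simpa [Real.dist_eq] using this

lemma psi_sub_le {c : ℝ} (hc : 0 < c) (x y : ℝ) : |psi c x - psi c y| ≤ |x - y| := by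
  have h1 := Real.lipschitzWith_sin.dist_le_mul (Real.arctan (x / c)) (Real.arctan (y / c))
  have h2 := arctan_sub_le (x / c) (y / c)
  simp only [Real.dist_eq, NNReal.coe_one, one_mul] at h1
  unfold psi
  rw [← mul_sub, abs_mul, abs_of_pos hc]
  have h3 : |x / c - y / c| = |x - y| / c := by
    rw [← sub_div, abs_div, abs_of_pos hc]
  rw [h3] at h2
  have h4 := h1.trans h2
  rw [le_div_iff₀ hc] at h4
  linarith

/-- periodic extension -/
lemma exists_ext {T : ℝ} (hT : 0 < T) (f : ℝ → ℝ) (hf : ContinuousOn f (Icc 0 T)) (h0 : f 0 = f T) :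
    ∃ g : ℝ → ℝ, Continuous g ∧ Function.Periodic g T ∧ ∀ t ∈ Icc 0 T, g t = f t := by
  have : Fact (0 < T) := ⟨hT⟩
  refine ⟨fun t => AddCircle.liftIco T 0 f (t : AddCircle T), ?_, ?_, ?_⟩
  · exact (AddCircle.liftIco_zero_continuous h0 hf).comp (AddCircle.continuous_mk' T)
  · intro t
    simp
  · intro t ht
    rcases eq_or_lt_of_le ht.2 with h | h
    · subst h
      have : ((t : ℝ) : AddCircle t) = ((0:ℝ) : AddCircle t) := by simp
      simp only [this]
      rw [AddCircle.liftIco_zero_coe_apply ⟨le_rfl, hT⟩, h0]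
    · exact AddCircle.liftIco_zero_coe_apply ⟨ht.1, h⟩

lemma ext_deriv {T : ℝ} (hT : 0 < T) (y g : ℝ → ℝ) (hy : Continuous y) (hg : Continuous g)
    (hyp : Function.Periodic y T) (hgp : Function.Periodic g T)
    (h : ∀ t ∈ Icc 0 T, HasDerivWithinAt y (g t) (Icc 0 T) t) (t : ℝ) : HasDerivAt y (g t) t := by
  have key : ∀ t ∈ Icc 0 T, ∫ s in (0:ℝ)..t, g s = y t - y 0 := by
    intro t ht
    apply intervalIntegral.integral_eq_sub_of_hasDeriv_right_of_le ht.1 hy.continuousOn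
    · intro s hs
      have hs' : s ∈ Ioo 0 T := ⟨hs.1, hs.2.trans_le ht.2⟩
      exact ((h s (Ioo_subset_Icc_self hs')).hasDerivAt (Icc_mem_nhds hs'.1 hs'.2)).hasDerivWithinAt
    · exact hg.intervalIntegrable _ _
  have hTT : ∫ s in (0:ℝ)..T, g s = 0 := by
    rw [key T ⟨hT.le, le_rfl⟩]
    have := hyp 0
    simp at this
    simp [this]
  have hDp : Function.Periodic (fun t => y t - ∫ s in (0:ℝ)..t, g s) T := by
    intro t
    have h1 : ∫ s in (0:ℝ)..(t+T), g s = (∫ s in (0:ℝ)..t, g s) + ∫ s in t..(t+T), g s := by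
      rw [intervalIntegral.integral_add_adjacent_intervals] <;> exact hg.intervalIntegrable _ _
    have h2 : ∫ s in t..(t+T), g s = ∫ s in (0:ℝ)..(0+T), g s := hgp.intervalIntegral_add_eq t 0
    simp only
    rw [h1, h2, zero_add, hTT, hyp t, add_zero]
  have hD : ∀ t, y t = y 0 + ∫ s in (0:ℝ)..t, g s := by
    intro t
    obtain ⟨s, hs, hst⟩ := hDp.exists_mem_Ico₀ hT t
    have hst : y t - (∫ s in (0:ℝ)..t, g s) = y s - ∫ s in (0:ℝ)..s, g s := hst
    rw [key s ⟨hs.1, hs.2.le⟩] at hst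
    linarith
  have hd : HasDerivAt (fun t => y 0 + ∫ s in (0:ℝ)..t, g s) (g t) t :=
    (intervalIntegral.integral_hasDerivAt_right (hg.intervalIntegrable _ _)
      (hg.stronglyMeasurableAtFilter _ _) hg.continuousAt).const_add _
  exact hd.congr_of_eventuallyEq (Filter.Eventually.of_forall hD)

/-- the vector field -/
noncomputable def vf (c a k : ℝ) (q : ℝ → ℝ) (t : ℝ) (X : ℝ × ℝ) : ℝ × ℝ :=
  (psi c X.2, q t + k * Real.arctan X.1 - a * psi c X.2)

lemma arctan_abs_le (x : ℝ) : |Real.arctan x| ≤ π / 2 := by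
  rw [abs_le]
  exact ⟨(Real.neg_pi_div_two_lt_arctan x).le, (Real.arctan_lt_pi_div_two x).le⟩

lemma vf_lip {c a k : ℝ} (hc : 0 < c) (ha : 0 < a) (hk : 0 ≤ k) (q : ℝ → ℝ) (t : ℝ) :
    LipschitzWith (Real.toNNReal (1 + k + a)) (vf c a k q t) := by
  apply LipschitzWith.of_dist_le_mul
  intro X Y
  rw [Real.coe_toNNReal _ (by positivity), Prod.dist_eq (x := vf c a k q t X)]
  have h1 : |X.1 - Y.1| ≤ dist X Y := by
    rw [Prod.dist_eq, Real.dist_eq, Real.dist_eq]; exact le_max_left _ _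
  have h2 : |X.2 - Y.2| ≤ dist X Y := by
    rw [Prod.dist_eq, Real.dist_eq, Real.dist_eq]; exact le_max_right _ _
  have h3 := psi_sub_le hc X.2 Y.2
  have h4 := arctan_sub_le X.1 Y.1
  have hd : 0 ≤ dist X Y := dist_nonneg
  have hkd : 0 ≤ k * dist X Y := by positivity
  have had : 0 ≤ a * dist X Y := by positivity
  apply max_le
  · simp only [vf, Real.dist_eq]
    nlinarith
  · simp only [vf, Real.dist_eq]
    have e : q t + k * arctan X.1 - a * psi c X.2 - (q t + k * arctan Y.1 - a * psi c Y.2)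
      = k * (arctan X.1 - arctan Y.1) - a * (psi c X.2 - psi c Y.2) := by ring
    rw [e]
    calc _ ≤ |k * (arctan X.1 - arctan Y.1)| + |a * (psi c X.2 - psi c Y.2)| := abs_sub _ _
      _ = k * |arctan X.1 - arctan Y.1| + a * |psi c X.2 - psi c Y.2| := by
        rw [abs_mul, abs_mul, abs_of_nonneg hk, abs_of_pos ha]
      _ ≤ k * dist X Y + a * dist X Y := by
        gcongr <;> linarith
      _ ≤ _ := by nlinarith

lemma vf_snd_bound {c a k M : ℝ} (hc : 0 < c) (ha : 0 < a) (hk : 0 ≤ k) {q : ℝ → ℝ}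
    (hq : ∀ t, |q t| ≤ M) (t : ℝ) (X : ℝ × ℝ) :
    |q t + k * Real.arctan X.1 - a * psi c X.2| ≤ M + k * (π / 2) + a * c := by
  calc _ ≤ |q t + k * Real.arctan X.1| + |a * psi c X.2| := abs_sub _ _
    _ ≤ |q t| + |k * Real.arctan X.1| + |a * psi c X.2| := by gcongr; exact abs_add_le _ _
    _ = |q t| + k * |Real.arctan X.1| + a * |psi c X.2| := by
        rw [abs_mul, abs_mul, abs_of_nonneg hk, abs_of_pos ha]
    _ ≤ _ := by
      gcongr
      · exact hq t
      · exact arctan_abs_le _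
      · exact (psi_abs_lt hc _).le

lemma exists_flow {c a k M T : ℝ} (hc : 0 < c) (ha : 0 < a) (hk : 0 ≤ k) (hT : 0 < T)
    {q : ℝ → ℝ} (hqc : Continuous q) (hq : ∀ t, |q t| ≤ M) :
    ∃ Φ : ℝ × ℝ → ℝ → ℝ × ℝ, (∀ x, Φ x 0 = x) ∧
      (∀ x, ∀ t ∈ Icc 0 T, HasDerivWithinAt (Φ x) (vf c a k q t (Φ x t)) (Icc 0 T) t) ∧
      Continuous (fun x => Φ x T) := by
  have hM : 0 ≤ M := (abs_nonneg _).trans (hq 0)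
  have ex : ∀ x : ℝ × ℝ, ∃ α : ℝ → ℝ × ℝ, α 0 = x ∧
      ∀ t ∈ Icc 0 T, HasDerivWithinAt α (vf c a k q t (α t)) (Icc 0 T) t := by
    intro x
    set L : ℝ := c + (M + k * (π / 2) + a * c) with hL
    have hL0 : 0 ≤ L := by positivity
    have hpl : IsPicardLindelof (vf c a k q) (tmin := 0) (tmax := T) ⟨0, le_rfl, hT.le⟩ x
        (Real.toNNReal (L * T)) 0 (Real.toNNReal L) (Real.toNNReal (1 + k + a)) := by
      constructor
      · intro t _
        exact (vf_lip hc ha hk q t).lipschitzOnWith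
      · intro X _
        unfold vf
        fun_prop
      · intro t _ X _
        rw [Real.coe_toNNReal _ hL0]
        have h2 := vf_snd_bound hc ha hk hq t X
        have h1 := psi_abs_lt hc X.2
        have h3 : 0 ≤ M + k * (π / 2) + a * c := by positivity
        rw [Prod.norm_def]
        apply max_le
        · simp only [vf, Real.norm_eq_abs]; linarith
        · simp only [vf, Real.norm_eq_abs]; linarith
      · rw [Real.coe_toNNReal _ hL0, Real.coe_toNNReal _ (by positivity)]
        simp [hT.le]
    exact hpl.exists_eq_forall_mem_Icc_hasDerivWithinAt₀
  choose Φ hΦ0 hΦ using ex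
  refine ⟨Φ, hΦ0, hΦ, ?_⟩
  have hLip : LipschitzWith (Real.toNNReal (Real.exp ((1 + k + a) * T))) (fun x => Φ x T) := by
    apply LipschitzWith.of_dist_le_mul
    intro x y
    rw [Real.coe_toNNReal _ (by positivity)]
    have hci : ∀ z, ContinuousOn (Φ z) (Icc 0 T) := fun z t ht => (hΦ z t ht).continuousWithinAt
    have hdi : ∀ z, ∀ t ∈ Ico 0 T, HasDerivWithinAt (Φ z) (vf c a k q t (Φ z t)) (Ici t) t := by
      intro z t ht
      exact (hΦ z t ⟨ht.1, ht.2.le⟩).mono_of_mem_nhdsWithin (Icc_mem_nhdsGE_of_mem ht)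
    have := dist_le_of_trajectories_ODE (vf_lip hc ha hk q) (hci x) (hdi x) (hci y) (hdi y)
      (le_refl (dist (Φ x 0) (Φ y 0))) T ⟨hT.le, le_rfl⟩
    rw [hΦ0, hΦ0, Real.coe_toNNReal _ (by positivity), sub_zero] at this
    linarith
  exact hLip.continuous

/-- trajectory on `[0,T]` -/
def IsTr (c a k T : ℝ) (q u w : ℝ → ℝ) : Prop :=
  (∀ t ∈ Icc 0 T, HasDerivWithinAt u (psi c (w t)) (Icc 0 T) t) ∧
  (∀ t ∈ Icc 0 T, HasDerivWithinAt w (q t + k * Real.arctan (u t) - a * psi c (w t)) (Icc 0 T) t)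

lemma pos_incr {T : ℝ} (hT : 0 < T) {y g : ℝ → ℝ}
    (hy : ∀ t ∈ Icc 0 T, HasDerivWithinAt y (g t) (Icc 0 T) t) (hg : ∀ t ∈ Icc 0 T, 0 < g t) :
    y 0 < y T := by
  have : StrictMonoOn y (Icc 0 T) := by
    apply strictMonoOn_of_hasDerivWithinAt_pos (convex_Icc 0 T) (f' := g)
    · exact fun t ht => (hy t ht).continuousWithinAt
    · intro t ht
      exact (hy t (interior_subset ht)).mono interior_subset
    · intro t ht
      exact hg t (interior_subset ht)
  exact this ⟨le_rfl, hT.le⟩ ⟨hT.le, le_rfl⟩ hT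

lemma incr_bound {T C : ℝ} {y g : ℝ → ℝ}
    (hy : ∀ t ∈ Icc 0 T, HasDerivWithinAt y (g t) (Icc 0 T) t) (hg : ∀ t ∈ Icc 0 T, |g t| ≤ C) :
    ∀ t ∈ Icc 0 T, |y t - y 0| ≤ C * T := by
  intro t ht
  have h0 : (0:ℝ) ∈ Icc 0 T := ⟨le_rfl, ht.1.trans ht.2⟩
  have := (convex_Icc 0 T).norm_image_sub_le_of_norm_hasDerivWithin_le hy hg h0 ht
  rw [Real.norm_eq_abs, Real.norm_eq_abs, sub_zero, abs_of_nonneg ht.1] at this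
  have hC : 0 ≤ C := (abs_nonneg _).trans (hg 0 h0)
  exact this.trans (by gcongr; exact ht.2)

lemma IsTr.unique {c a k T : ℝ} (hc : 0 < c) (hk : 0 ≤ k) (hT : 0 < T)
    {q u w u' w' : ℝ → ℝ} (h : IsTr c a k T q u w) (h' : IsTr c a k T q u' w')
    (h0 : u 0 = u' 0) (h1 : u T = u' T) : w 0 = w' 0 := by
  have hmul : ∀ x y : ℝ, 0 ≤ (x - y) * (psi c x - psi c y) := by
    intro x y
    rcases le_total x y with hxy | hxy
    · exact mul_nonneg_of_nonpos_of_nonpos (by linarith) (by linarith [(psi_mono hc).monotone hxy])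
    · exact mul_nonneg (by linarith) (by linarith [(psi_mono hc).monotone hxy])
  have hmul' : ∀ x y : ℝ, 0 ≤ (x - y) * (arctan x - arctan y) := by
    intro x y
    rcases le_total x y with hxy | hxy
    · exact mul_nonneg_of_nonpos_of_nonpos (by linarith)
        (by linarith [Real.arctan_strictMono.monotone hxy])
    · exact mul_nonneg (by linarith) (by linarith [Real.arctan_strictMono.monotone hxy])
  let E : ℝ → ℝ := fun t => (w t - w' t) * (u t - u' t) + a / 2 * (u t - u' t) ^ 2
  let E' : ℝ → ℝ := fun t => (w t - w' t) * (psi c (w t) - psi c (w' t)) +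
    k * ((u t - u' t) * (arctan (u t) - arctan (u' t)))
  have hE : ∀ t ∈ Icc 0 T, HasDerivWithinAt E (E' t) (Icc 0 T) t := by
    intro t ht
    have d1 := (h.1 t ht).sub (h'.1 t ht)
    have d2 := (h.2 t ht).sub (h'.2 t ht)
    have := (d2.mul d1).add ((d1.pow 2).const_mul (a / 2))
    refine this.congr_deriv ?_
    simp only [E', Pi.sub_apply]
    push_cast
    ring
  have hE' : ∀ t, 0 ≤ E' t := by
    intro t
    exact add_nonneg (hmul _ _) (mul_nonneg hk (hmul' _ _))
  have hmono : MonotoneOn E (Icc 0 T) := by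
    apply monotoneOn_of_hasDerivWithinAt_nonneg (convex_Icc 0 T) (f' := E')
    · exact fun t ht => (hE t ht).continuousWithinAt
    · intro t ht
      exact (hE t (interior_subset ht)).mono interior_subset
    · intro t ht
      exact hE' t
  have m0 : (0:ℝ) ∈ Icc 0 T := ⟨le_rfl, hT.le⟩
  have mT : T ∈ Icc 0 T := ⟨hT.le, le_rfl⟩
  have hE0 : E 0 = 0 := by simp [E, h0]
  have hET : E T = 0 := by simp [E, h1]
  have hz : ∀ t ∈ Icc 0 T, E t = 0 := by
    intro t ht
    have a1 := hmono m0 ht ht.1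
    have a2 := hmono ht mT ht.2
    linarith
  have hd : HasDerivWithinAt E 0 (Icc 0 T) 0 :=
    (hasDerivWithinAt_const (0:ℝ) (Icc 0 T) (0:ℝ)).congr hz hE0
  have he : E' 0 = 0 := (uniqueDiffOn_Icc hT 0 m0).eq_deriv _ (hE 0 m0) hd
  simp only [E', h0, sub_self, mul_zero, add_zero] at he
  rcases mul_eq_zero.1 he with h2 | h2
  · linarith
  · exact (psi_mono hc).injective (by linarith)

lemma vf_isTr {c a k T : ℝ} {q : ℝ → ℝ} {Φ : ℝ × ℝ → ℝ → ℝ × ℝ}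
    (hΦ : ∀ x, ∀ t ∈ Icc 0 T, HasDerivWithinAt (Φ x) (vf c a k q t (Φ x t)) (Icc 0 T) t)
    (x : ℝ × ℝ) : IsTr c a k T q (fun t => (Φ x t).1) (fun t => (Φ x t).2) :=
  ⟨fun t ht => (hΦ x t ht).fst, fun t ht => (hΦ x t ht).snd⟩

/-- Dirichlet problem by shooting -/
lemma exists_dirichlet {c a k M T : ℝ} (hc : 0 < c) (ha : 0 < a) (hk : 0 ≤ k) (hT : 0 < T)
    {q : ℝ → ℝ} (hq : ∀ t, |q t| ≤ M)
    {Φ : ℝ × ℝ → ℝ → ℝ × ℝ} (hΦ0 : ∀ x, Φ x 0 = x)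
    (hΦ : ∀ x, ∀ t ∈ Icc 0 T, HasDerivWithinAt (Φ x) (vf c a k q t (Φ x t)) (Icc 0 T) t)
    (hcont : Continuous (fun x => Φ x T)) {R : ℝ} (hR : (M + k * (π / 2) + a * c) * T < R) (u₀ : ℝ) :
    ∃ w₀ ∈ Icc (-R) R, (Φ (u₀, w₀) T).1 = u₀ := by
  have hM : 0 ≤ M := (abs_nonneg _).trans (hq 0)
  have hR0 : 0 < R := lt_of_le_of_lt (by positivity) hR
  have hb : ∀ w₀, ∀ t ∈ Icc 0 T, |(Φ (u₀, w₀) t).2 - w₀| < R := by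
    intro w₀ t ht
    have := incr_bound (vf_isTr hΦ (u₀, w₀)).2 (fun t _ => vf_snd_bound hc ha hk hq t _) t ht
    rw [hΦ0] at this
    exact this.trans_lt hR
  have h1 : u₀ < (Φ (u₀, R) T).1 := by
    have := pos_incr hT (vf_isTr hΦ (u₀, R)).1 (fun t ht => psi_pos hc (by
      have := (abs_lt.1 (hb R t ht)).1
      linarith))
    rwa [hΦ0] at this
  have h2 : (Φ (u₀, -R) T).1 < u₀ := by
    have := pos_incr hT (fun t ht => ((vf_isTr hΦ (u₀, -R)).1 t ht).neg) (fun t ht =>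
      neg_pos.2 (psi_neg hc (by
      have := (abs_lt.1 (hb (-R) t ht)).2
      linarith)))
    simp only [Pi.neg_apply, hΦ0] at this
    linarith
  have hf : ContinuousOn (fun w₀ => (Φ (u₀, w₀) T).1) (Icc (-R) R) := by
    have : Continuous (fun w₀ : ℝ => (u₀, w₀)) := by fun_prop
    exact (continuous_fst.comp (hcont.comp this)).continuousOn
  obtain ⟨w₀, hw₀, h⟩ := intermediate_value_Icc (by linarith) hf ⟨h2.le, h1.le⟩
  exact ⟨w₀, hw₀, h⟩

lemma IsTr.zsum {c a k T : ℝ} {q u w : ℝ → ℝ} (h : IsTr c a k T q u w) :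
    ∀ t ∈ Icc 0 T, HasDerivWithinAt (fun t => w t + a * u t) (q t + k * Real.arctan (u t))
      (Icc 0 T) t := by
  intro t ht
  refine ((h.2 t ht).add ((h.1 t ht).const_mul a)).congr_deriv ?_
  ring

/-- periodic trajectory on the line -/
def IsPer (c T : ℝ) (g u w : ℝ → ℝ) : Prop :=
  Function.Periodic u T ∧ (∀ t, HasDerivAt u (psi c (w t)) t) ∧ (∀ t, HasDerivAt w (g t) t)

lemma IsTr.ext {c a k T : ℝ} (hT : 0 < T) {q u w : ℝ → ℝ} (hq : Continuous q)
    (hqp : Function.Periodic q T) (h : IsTr c a k T q u w)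
    (hu : u 0 = u T) (hw : w 0 = w T) : ∃ U W : ℝ → ℝ, U 0 = u 0 ∧ W 0 = w 0 ∧
      IsPer c T (fun t => q t + k * Real.arctan (U t) - a * psi c (W t)) U W := by
  obtain ⟨U, hUc, hUp, hU⟩ := exists_ext hT u (fun t ht => (h.1 t ht).continuousWithinAt) hu
  obtain ⟨W, hWc, hWp, hW⟩ := exists_ext hT w (fun t ht => (h.2 t ht).continuousWithinAt) hw
  have m0 : (0:ℝ) ∈ Icc 0 T := ⟨le_rfl, hT.le⟩
  have hpsi := psi_cont c
  refine ⟨U, W, hU 0 m0, hW 0 m0, hUp, ?_, ?_⟩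
  · apply ext_deriv hT U (fun t => psi c (W t)) hUc (by fun_prop) hUp
    · intro t; simp only [hWp t]
    · intro t ht
      rw [hW t ht]
      exact (h.1 t ht).congr hU (hU t ht)
  · apply ext_deriv hT W _ hWc (by fun_prop) hWp
    · intro t; simp only [hWp t, hUp t, hqp t]
    · intro t ht
      rw [hW t ht, hU t ht]
      exact (h.2 t ht).congr hW (hW t ht)

/-- periodic problem without the restoring term -/
lemma exists_free {c a T : ℝ} (hc : 0 < c) (ha : 0 < a) (hT : 0 < T)
    {q : ℝ → ℝ} (hqc : Continuous q) (hqp : Function.Periodic q T)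
    {M : ℝ} (hq : ∀ t, |q t| ≤ M) (hq0 : ∫ t in (0:ℝ)..T, q t = 0) :
    ∃ u w : ℝ → ℝ, IsPer c T (fun t => q t - a * psi c (w t)) u w := by
  obtain ⟨Φ, hΦ0, hΦ, hcont⟩ := exists_flow hc ha (le_refl (0:ℝ)) hT hqc hq
  obtain ⟨w₀, -, hw₀⟩ := exists_dirichlet hc ha le_rfl hT hq hΦ0 hΦ hcont (lt_add_one _) 0
  have htr := vf_isTr hΦ (0, w₀)
  have hz := htr.zsum
  have key : ∫ s in (0:ℝ)..T, q s = ((Φ (0, w₀) T).2 + a * (Φ (0, w₀) T).1)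
      - ((Φ (0, w₀) 0).2 + a * (Φ (0, w₀) 0).1) := by
    apply intervalIntegral.integral_eq_sub_of_hasDeriv_right_of_le hT.le
      (f := fun t => (Φ (0, w₀) t).2 + a * (Φ (0, w₀) t).1)
    · exact fun t ht => (hz t ht).continuousWithinAt
    · intro s hs
      have := ((hz s (Ioo_subset_Icc_self hs)).hasDerivAt
        (Icc_mem_nhds hs.1 hs.2)).hasDerivWithinAt (s := Ioi s)
      simpa using this
    · exact hqc.intervalIntegrable _ _
  rw [hq0, hΦ0, hw₀] at key
  simp only [mul_zero, add_zero] at key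
  obtain ⟨U, W, -, -, h⟩ := htr.ext hT hqc hqp (by simp only [hΦ0, hw₀])
    (by simp only [hΦ0]; linarith)
  exact ⟨U, W, by simpa using h⟩

/-- periodic problem with monotone restoring term -/
lemma exists_solve {c a k M T : ℝ} (hc : 0 < c) (ha : 0 < a) (hk : 0 < k) (hT : 0 < T)
    {q : ℝ → ℝ} (hqc : Continuous q) (hqp : Function.Periodic q T)
    (hq : ∀ t, |q t| ≤ M) (hMk : M < k * (π / 2)) :
    ∃ u w : ℝ → ℝ, |w 0| ≤ (M + k * (π / 2) + a * c) * T + 1 ∧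
      IsPer c T (fun t => q t + k * Real.arctan (u t) - a * psi c (w t)) u w := by
  have hM : 0 ≤ M := (abs_nonneg _).trans (hq 0)
  set R := (M + k * (π / 2) + a * c) * T + 1 with hR
  obtain ⟨Φ, hΦ0, hΦ, hcont⟩ := exists_flow hc ha hk.le hT hqc hq
  have hD := exists_dirichlet hc ha hk.le hT hq hΦ0 hΦ hcont (lt_add_one _)
  rw [← hR] at hD
  have hMk' : M / k < π / 2 := by rw [div_lt_iff₀ hk]; linarith
  have hMk0 : 0 ≤ M / k := by positivity
  set N := Real.tan (M / k) + c * T + 1 with hN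
  have hN0 : 0 ≤ N := by
    have : 0 ≤ Real.tan (M / k) := Real.tan_nonneg_of_nonneg_of_le_pi_div_two hMk0 hMk'.le
    positivity
  have harct : arctan (tan (M / k)) = M / k :=
    Real.arctan_tan (by linarith) hMk'
  let A : Set ℝ := Prod.fst '' ((Icc (-N) N ×ˢ Icc (-R) R) ∩
    {x : ℝ × ℝ | (Φ x T).1 = x.1 ∧ (Φ x T).2 ≤ x.2})
  let B : Set ℝ := Prod.fst '' ((Icc (-N) N ×ˢ Icc (-R) R) ∩
    {x : ℝ × ℝ | (Φ x T).1 = x.1 ∧ x.2 ≤ (Φ x T).2})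
  have hAc : IsClosed A := by
    apply IsCompact.isClosed
    apply IsCompact.image _ continuous_fst
    apply (isCompact_Icc.prod isCompact_Icc).inter_right
    exact (isClosed_eq (continuous_fst.comp hcont) continuous_fst).inter
      (isClosed_le (continuous_snd.comp hcont) continuous_snd)
  have hBc : IsClosed B := by
    apply IsCompact.isClosed
    apply IsCompact.image _ continuous_fst
    apply (isCompact_Icc.prod isCompact_Icc).inter_right
    exact (isClosed_eq (continuous_fst.comp hcont) continuous_fst).inter
      (isClosed_le continuous_snd (continuous_snd.comp hcont))
  have hcov : Icc (-N) N ⊆ A ∪ B := by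
    intro u₀ hu₀
    obtain ⟨w₀, hw, h⟩ := hD u₀
    rcases le_total (Φ (u₀, w₀) T).2 w₀ with h' | h'
    · exact Or.inl ⟨(u₀, w₀), ⟨⟨hu₀, hw⟩, h, h'⟩, rfl⟩
    · exact Or.inr ⟨(u₀, w₀), ⟨⟨hu₀, hw⟩, h, h'⟩, rfl⟩
  have hub : ∀ x : ℝ × ℝ, ∀ t ∈ Icc 0 T, |(Φ x t).1 - x.1| ≤ c * T := by
    intro x t ht
    have := incr_bound (vf_isTr hΦ x).1 (fun t _ => (psi_abs_lt hc _).le) t ht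
    rwa [hΦ0] at this
  have hBne : (Icc (-N) N ∩ B).Nonempty := by
    obtain ⟨w₀, hw, h⟩ := hD N
    have hm : N ∈ Icc (-N) N := ⟨by linarith, le_rfl⟩
    refine ⟨N, hm, (N, w₀), ⟨⟨hm, hw⟩, h, ?_⟩, rfl⟩
    have hz := pos_incr hT (vf_isTr hΦ (N, w₀)).zsum (fun t ht => by
      have h1 := (abs_le.1 (hub (N, w₀) t ht)).1
      have h2 : tan (M / k) < (Φ (N, w₀) t).1 := by simp only at h1; linarith
      have h3 := Real.arctan_strictMono h2
      rw [harct, div_lt_iff₀ hk] at h3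
      have h4 := (abs_le.1 (hq t)).1
      linarith)
    simp only [hΦ0, h] at hz
    simp only
    linarith
  have hAne : (Icc (-N) N ∩ A).Nonempty := by
    obtain ⟨w₀, hw, h⟩ := hD (-N)
    have hm : -N ∈ Icc (-N) N := ⟨le_rfl, by linarith⟩
    refine ⟨-N, hm, (-N, w₀), ⟨⟨hm, hw⟩, h, ?_⟩, rfl⟩
    have hz := pos_incr hT (fun t ht => ((vf_isTr hΦ (-N, w₀)).zsum t ht).neg) (fun t ht => by
      have h1 := (abs_le.1 (hub (-N, w₀) t ht)).2
      have h2 : (Φ (-N, w₀) t).1 < -tan (M / k) := by simp only at h1; linarith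
      have h3 := Real.arctan_strictMono h2
      rw [Real.arctan_neg, harct, lt_neg, div_lt_iff₀ hk] at h3
      have h4 := (abs_le.1 (hq t)).2
      linarith)
    simp only [Pi.neg_apply, hΦ0, h] at hz
    simp only
    linarith
  obtain ⟨u₀, -, ⟨x, ⟨⟨-, hx⟩, hx1, hx2⟩, hxu⟩, ⟨y, ⟨-, hy1, hy2⟩, hyu⟩⟩ :=
    isPreconnected_closed_iff.1 isPreconnected_Icc A B hAc hBc hcov hAne hBne
  have hxy : x = y := by
    apply Prod.ext (hxu.trans hyu.symm)
    have := (vf_isTr hΦ x).unique hc hk.le hT (vf_isTr hΦ y)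
      (by simp only [hΦ0]; exact hxu.trans hyu.symm)
      (by rw [hx1, hy1]; exact hxu.trans hyu.symm)
    simpa only [hΦ0] using this
  subst hxy
  obtain ⟨U, W, -, hW, h⟩ := (vf_isTr hΦ x).ext hT hqc hqp (by simp only [hΦ0, hx1])
    (by simp only [hΦ0]; exact le_antisymm hy2 hx2)
  refine ⟨U, W, ?_, h⟩
  rw [hW, hΦ0, abs_le]
  exact hx

lemma IsPer.cont {c T : ℝ} {g u w : ℝ → ℝ} (h : IsPer c T g u w) : Continuous u ∧ Continuous w :=
  ⟨continuous_iff_continuousAt.2 fun t => (h.2.1 t).continuousAt,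
    continuous_iff_continuousAt.2 fun t => (h.2.2 t).continuousAt⟩

lemma IsPer.lip {c T : ℝ} (hc : 0 < c) {g u w : ℝ → ℝ} (h : IsPer c T g u w) (x y : ℝ) :
    |u x - u y| ≤ c * |x - y| := by
  have := (convex_univ (𝕜 := ℝ) (E := ℝ)).norm_image_sub_le_of_norm_hasDerivWithin_le (f := u)
    (f' := fun t => psi c (w t)) (C := c)
    (fun t _ => (h.2.1 t).hasDerivWithinAt) (fun t _ => (psi_abs_lt hc _).le) (mem_univ y)
    (mem_univ x)
  exact this

lemma per_max {T : ℝ} (hT : 0 < T) {d : ℝ → ℝ} (hd : Continuous d) (hp : Function.Periodic d T) :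
    ∃ t₀ ∈ Icc 0 T, ∀ t, d t ≤ d t₀ := by
  obtain ⟨t₀, ht₀, h⟩ := isCompact_Icc.exists_isMaxOn (nonempty_Icc.2 hT.le) hd.continuousOn
  refine ⟨t₀, ht₀, fun t => ?_⟩
  obtain ⟨s, hs, hst⟩ := hp.exists_mem_Ico₀ hT t
  rw [hst]
  exact h ⟨hs.1, hs.2.le⟩

lemma compare {c a k T : ℝ} (hc : 0 < c) (hk : 0 < k) (hT : 0 < T)
    {q g₁ u₁ w₁ g₂ u₂ w₂ : ℝ → ℝ} (h₁ : IsPer c T g₁ u₁ w₁) (h₂ : IsPer c T g₂ u₂ w₂)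
    (hg₁ : ∀ t, q t + k * arctan (u₁ t) - a * psi c (w₁ t) ≤ g₁ t)
    (hg₂ : ∀ t, g₂ t ≤ q t + k * arctan (u₂ t) - a * psi c (w₂ t)) :
    ∀ t, u₁ t ≤ u₂ t := by
  obtain ⟨t₀, -, hmax⟩ := per_max hT (h₁.cont.1.sub h₂.cont.1) (h₁.1.sub h₂.1)
  simp only [Pi.sub_apply] at hmax
  by_contra hcon
  push Not at hcon
  obtain ⟨t₁, ht₁⟩ := hcon
  have hpos : u₂ t₀ < u₁ t₀ := by linarith [hmax t₁]
  have hd : ∀ t, HasDerivAt (fun t => u₁ t - u₂ t) (psi c (w₁ t) - psi c (w₂ t)) t :=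
    fun t => (h₁.2.1 t).sub (h₂.2.1 t)
  have hloc : IsLocalMax (fun t => u₁ t - u₂ t) t₀ := Filter.Eventually.of_forall hmax
  have h0 := hloc.hasDerivAt_eq_zero (hd t₀)
  have hw0 : w₁ t₀ = w₂ t₀ := (psi_mono hc).injective (by linarith)
  have hdw : HasDerivAt (fun t => w₁ t - w₂ t) (g₁ t₀ - g₂ t₀) t₀ := (h₁.2.2 t₀).sub (h₂.2.2 t₀)
  have hgpos : 0 < g₁ t₀ - g₂ t₀ := by
    have e1 := hg₁ t₀
    have e2 := hg₂ t₀
    rw [hw0] at e1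
    have e3 := Real.arctan_strictMono hpos
    nlinarith
  -- right after `t₀` the difference of momenta is positive
  have hev : ∀ᶠ t in nhdsWithin t₀ (Ioi t₀), 0 < slope (fun t => w₁ t - w₂ t) t₀ t := by
    have := (hasDerivAt_iff_tendsto_slope.1 hdw).eventually (lt_mem_nhds hgpos)
    exact this.filter_mono (nhdsWithin_mono _ (fun x hx => ne_of_gt hx))
  obtain ⟨t₂, ht₂, hsub⟩ := mem_nhdsGT_iff_exists_Ioo_subset.1 hev
  have ht₂ : t₀ < t₂ := ht₂
  have hwpos : ∀ t ∈ Ioo t₀ t₂, w₂ t < w₁ t := by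
    intro t ht
    have h3 : 0 < slope (fun t => w₁ t - w₂ t) t₀ t := hsub ht
    rw [slope_def_field] at h3
    simp only [hw0, sub_self, sub_zero] at h3
    have h4 : 0 < t - t₀ := by linarith [ht.1]
    rw [div_pos_iff_of_pos_right h4] at h3
    linarith
  have hsm : StrictMonoOn (fun t => u₁ t - u₂ t) (Icc t₀ t₂) := by
    apply strictMonoOn_of_hasDerivWithinAt_pos (convex_Icc t₀ t₂)
      (f' := fun t => psi c (w₁ t) - psi c (w₂ t))
    · exact fun t _ => (hd t).continuousAt.continuousWithinAt
    · intro t _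
      exact (hd t).hasDerivWithinAt
    · intro t ht
      rw [interior_Icc] at ht
      have := psi_mono hc (hwpos t ht)
      linarith
  have := hsm ⟨le_rfl, ht₂.le⟩ ⟨ht₂.le, le_rfl⟩ ht₂
  simp only at this
  linarith [hmax t₂]

lemma G_mono {b k : ℝ} (hb : 0 < b) (hk : b * (1 + (2 * π) ^ 2) ≤ k) {x y : ℝ} (hx : 0 ≤ x)
    (hxy : x ≤ y) (hy : y ≤ 2 * π) : b * sin x + k * arctan x ≤ b * sin y + k * arctan y := by
  have hd : ∀ t, HasDerivAt (fun t => b * sin t + k * arctan t)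
      (b * cos t + k * (1 / (1 + t ^ 2))) t := fun t =>
    ((Real.hasDerivAt_sin t).const_mul b).add ((Real.hasDerivAt_arctan t).const_mul k)
  have : MonotoneOn (fun t => b * sin t + k * arctan t) (Icc 0 (2 * π)) := by
    apply monotoneOn_of_hasDerivWithinAt_nonneg (convex_Icc _ _)
      (f' := fun t => b * cos t + k * (1 / (1 + t ^ 2)))
    · exact fun t _ => (hd t).continuousAt.continuousWithinAt
    · intro t _
      exact (hd t).hasDerivWithinAt
    · intro t ht
      rw [interior_Icc] at ht
      have h1 : b * (1 + t ^ 2) ≤ k := by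
        refine le_trans ?_ hk
        have := ht.1
        have := ht.2
        gcongr
      have h2 : b ≤ k * (1 / (1 + t ^ 2)) := by
        rw [mul_one_div, le_div_iff₀ (by positivity)]
        exact h1
      have h3 := Real.neg_one_le_cos t
      nlinarith
  exact this ⟨hx, hxy.trans hy⟩ ⟨hx.trans hxy, hy⟩ hxy

lemma per_bdd {T : ℝ} (hT : 0 < T) {d : ℝ → ℝ} (hd : Continuous d) (hp : Function.Periodic d T) :
    ∃ M, ∀ t, |d t| ≤ M := by
  obtain ⟨t₀, -, h⟩ := per_max hT (d := fun t => |d t|) hd.abs (fun t => by simp only [hp t])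
  exact ⟨_, h⟩

/-- one step of the monotone iteration -/
lemma iter_step {c a b k P₀ T : ℝ} (hc : 0 < c) (ha : 0 < a) (hb : 0 < b) (hT : 0 < T)
    {P : ℝ → ℝ} (hPc : Continuous P) (hPp : Function.Periodic P T) (hP : ∀ t, |P t| ≤ P₀)
    (hk : b * (1 + (2 * π) ^ 2) ≤ k) (hk' : P₀ + b + k * arctan (2 * π) < k * (π / 2))
    {β wβ gβ : ℝ → ℝ} (hβ : IsPer c T gβ β wβ) (hβ2 : ∀ t, β t ≤ 2 * π)
    (hgβ : ∀ t, gβ t ≤ P t - b * sin (β t) - a * psi c (wβ t))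
    {u w g : ℝ → ℝ} (hu : IsPer c T g u w) (hu0 : ∀ t, 0 ≤ u t) (huβ : ∀ t, u t ≤ β t)
    (hg : ∀ t, P t - b * sin (u t) - a * psi c (w t) ≤ g t) :
    ∃ u' w' : ℝ → ℝ,
      IsPer c T (fun t => P t - b * sin (u t) - k * arctan (u t) + k * arctan (u' t)
        - a * psi c (w' t)) u' w' ∧
      |w' 0| ≤ (P₀ + b + k * arctan (2 * π) + k * (π / 2) + a * c) * T + 1 ∧
      (∀ t, u t ≤ u' t) ∧ (∀ t, u' t ≤ β t) ∧
      ∀ t, P t - b * sin (u' t) - a * psi c (w' t) ≤ P t - b * sin (u t) - k * arctan (u t) +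
        k * arctan (u' t) - a * psi c (w' t) := by
  have hk0 : 0 < k := lt_of_lt_of_le (by positivity) hk
  have huc := hu.cont.1
  have hq : ∀ t, |P t - b * sin (u t) - k * arctan (u t)| ≤ P₀ + b + k * arctan (2 * π) := by
    intro t
    have h1 := abs_le.1 (hP t)
    have h2 := Real.sin_le_one (u t)
    have h3 := Real.neg_one_le_sin (u t)
    have h4 : 0 ≤ arctan (u t) := Real.arctan_nonneg.2 (hu0 t)
    have h5 : arctan (u t) ≤ arctan (2 * π) :=
      Real.arctan_strictMono.monotone ((huβ t).trans (hβ2 t))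
    have h6 : k * arctan (u t) ≤ k * arctan (2 * π) := by gcongr
    have h7 : 0 ≤ k * arctan (u t) := by positivity
    rw [abs_le]
    constructor <;> nlinarith
  obtain ⟨u', w', hw0, hu'⟩ := exists_solve hc ha hk0 hT
    (q := fun t => P t - b * sin (u t) - k * arctan (u t)) (by fun_prop)
    (fun t => by simp only [hPp t, hu.1 t]) hq hk'
  have h1 : ∀ t, u t ≤ u' t := by
    refine compare (a := a) hc hk0 hT (q := fun t => P t - b * sin (u t) - k * arctan (u t)) hu hu'
      (fun t => ?_) (fun t => le_rfl)
    have := hg t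
    linarith
  have h2 : ∀ t, u' t ≤ β t := by
    refine compare (a := a) hc hk0 hT (q := fun t => P t - b * sin (u t) - k * arctan (u t)) hu' hβ
      (fun t => le_rfl) (fun t => ?_)
    have := hgβ t
    have := G_mono hb hk (hu0 t) (huβ t) (hβ2 t)
    linarith
  refine ⟨u', w', hu', hw0, h1, h2, fun t => ?_⟩
  have := G_mono hb hk (hu0 t) (h1 t) ((h2 t).trans (hβ2 t))
  linarith

lemma exists_k {b P₀ : ℝ} : ∃ k, b * (1 + (2 * π) ^ 2) ≤ k ∧
    P₀ + b + k * arctan (2 * π) < k * (π / 2) := by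
  have h : 0 < π / 2 - arctan (2 * π) := by linarith [Real.arctan_lt_pi_div_two (2 * π)]
  refine ⟨max (b * (1 + (2 * π) ^ 2)) ((P₀ + b + 1) / (π / 2 - arctan (2 * π))), le_max_left _ _, ?_⟩
  have h2 := le_max_right (b * (1 + (2 * π) ^ 2)) ((P₀ + b + 1) / (π / 2 - arctan (2 * π)))
  rw [div_le_iff₀ h] at h2
  linarith

lemma eq_integral {y g : ℝ → ℝ} (hg : Continuous g) (h : ∀ t, HasDerivAt y (g t) t) (t : ℝ) :
    y t = y 0 + ∫ s in (0:ℝ)..t, g s := by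
  rw [intervalIntegral.integral_eq_sub_of_hasDerivAt (fun s _ => h s) (hg.intervalIntegrable _ _)]
  ring

lemma hasDeriv_integral {y g : ℝ → ℝ} (hg : Continuous g)
    (h : ∀ t, y t = y 0 + ∫ s in (0:ℝ)..t, g s) (t : ℝ) : HasDerivAt y (g t) t := by
  have hd : HasDerivAt (fun t => y 0 + ∫ s in (0:ℝ)..t, g s) (g t) t :=
    (intervalIntegral.integral_hasDerivAt_right (hg.intervalIntegrable _ _)
      (hg.stronglyMeasurableAtFilter _ _) hg.continuousAt).const_add _
  exact hd.congr_of_eventuallyEq (Filter.Eventually.of_forall h)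

lemma dom_conv {F : ℕ → ℝ → ℝ} {f : ℝ → ℝ} {C : ℝ} (hF : ∀ n, Continuous (F n))
    (hC : ∀ n t, |F n t| ≤ C) (hlim : ∀ t, Filter.Tendsto (fun n => F n t) Filter.atTop (nhds (f t)))
    (t : ℝ) : Filter.Tendsto (fun n => ∫ s in (0:ℝ)..t, F n s) Filter.atTop
      (nhds (∫ s in (0:ℝ)..t, f s)) := by
  apply intervalIntegral.tendsto_integral_filter_of_dominated_convergence (fun _ => C)
  · exact Filter.Eventually.of_forall fun n => (hF n).aestronglyMeasurable
  · exact Filter.Eventually.of_forall fun n => Filter.Eventually.of_forall fun s _ => hC n s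
  · exact intervalIntegrable_const
  · exact Filter.Eventually.of_forall fun s _ => hlim s

/-- existence between ordered lower and upper solutions -/
lemma exists_sol_between {c a b T : ℝ} (hc : 0 < c) (ha : 0 < a) (hb : 0 < b) (hT : 0 < T)
    {P : ℝ → ℝ} (hPc : Continuous P) (hPp : Function.Periodic P T)
    {α wα gα β wβ gβ : ℝ → ℝ} (hα : IsPer c T gα α wα) (hβ : IsPer c T gβ β wβ)
    (hα0 : ∀ t, 0 ≤ α t) (hαβ : ∀ t, α t ≤ β t) (hβ2 : ∀ t, β t ≤ 2 * π)
    (hgα : ∀ t, P t - b * sin (α t) - a * psi c (wα t) ≤ gα t)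
    (hgβ : ∀ t, gβ t ≤ P t - b * sin (β t) - a * psi c (wβ t)) :
    ∃ u w : ℝ → ℝ, IsPer c T (fun t => P t - b * sin (u t) - a * psi c (w t)) u w := by
  obtain ⟨P₀, hP⟩ := per_bdd hT hPc hPp
  obtain ⟨k, hk, hk'⟩ := exists_k (b := b) (P₀ := P₀)
  have hk0 : 0 < k := lt_of_lt_of_le (by positivity) hk
  set R := (P₀ + b + k * arctan (2 * π) + k * (π / 2) + a * c) * T + 1 with hR
  let S := {x : (ℝ → ℝ) × (ℝ → ℝ) // ∃ g, IsPer c T g x.1 x.2 ∧ (∀ t, 0 ≤ x.1 t) ∧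
    (∀ t, x.1 t ≤ β t) ∧ ∀ t, P t - b * sin (x.1 t) - a * psi c (x.2 t) ≤ g t}
  have hstep : ∀ x : S, ∃ y : S,
      IsPer c T (fun t => P t - b * sin (x.1.1 t) - k * arctan (x.1.1 t) + k * arctan (y.1.1 t)
        - a * psi c (y.1.2 t)) y.1.1 y.1.2 ∧ |y.1.2 0| ≤ R ∧ ∀ t, x.1.1 t ≤ y.1.1 t := by
    rintro ⟨⟨u, w⟩, g, h1, h2, h3, h4⟩
    obtain ⟨u', w', k1, k2, k3, k4, k5⟩ :=
      iter_step hc ha hb hT hPc hPp hP hk hk' hβ hβ2 hgβ h1 h2 h3 h4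
    exact ⟨⟨(u', w'), _, k1, fun t => (h2 t).trans (k3 t), k4, k5⟩, k1, k2, k3⟩
  choose F hF1 hF2 hF3 using hstep
  let x0 : S := ⟨(α, wα), gα, hα, hα0, hαβ, hgα⟩
  let seq : ℕ → S := fun n => Nat.rec x0 (fun _ x => F x) n
  let U : ℕ → ℝ → ℝ := fun n => (seq n).1.1
  let W : ℕ → ℝ → ℝ := fun n => (seq n).1.2
  have hper : ∀ n, IsPer c T (fun t => P t - b * sin (U n t) - k * arctan (U n t) +
      k * arctan (U (n+1) t) - a * psi c (W (n+1) t)) (U (n+1)) (W (n+1)) := fun n => hF1 (seq n)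
  have hWb : ∀ n, |W (n+1) 0| ≤ R := fun n => hF2 (seq n)
  have hmono : ∀ n t, U n t ≤ U (n+1) t := fun n => hF3 (seq n)
  have hperU : ∀ n, ∃ g, IsPer c T g (U n) (W n) := by
    intro n
    obtain ⟨g, h, -⟩ := (seq n).2
    exact ⟨g, h⟩
  have hUc : ∀ n, Continuous (U n) := fun n => by
    obtain ⟨g, h⟩ := hperU n
    exact h.cont.1
  have hWc : ∀ n, Continuous (W n) := fun n => by
    obtain ⟨g, h⟩ := hperU n
    exact h.cont.2
  have hU2 : ∀ n t, U n t ≤ 2 * π := by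
    intro n t
    obtain ⟨g, -, -, h, -⟩ := (seq n).2
    exact (h t).trans (hβ2 t)
  -- the pointwise limit
  have hlim : ∀ t, ∃ v, Filter.Tendsto (fun n => U n t) Filter.atTop (nhds v) := by
    intro t
    refine ⟨_, tendsto_atTop_ciSup (monotone_nat_of_le_succ fun n => hmono n t) ⟨2 * π, ?_⟩⟩
    rintro _ ⟨n, rfl⟩
    exact hU2 n t
  choose V hV using hlim
  have hVp : Function.Periodic V T := by
    intro t
    refine tendsto_nhds_unique (hV (t + T)) ((hV t).congr fun n => ?_)
    obtain ⟨g, h⟩ := hperU n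
    exact (h.1 t).symm
  have hVlip : ∀ x y, |V x - V y| ≤ c * |x - y| := by
    intro x y
    refine le_of_tendsto ((hV x).sub (hV y)).abs (Filter.Eventually.of_forall fun n => ?_)
    obtain ⟨g, h⟩ := hperU n
    exact h.lip hc x y
  have hVc : Continuous V := by
    have : LipschitzWith (Real.toNNReal c) V := by
      apply LipschitzWith.of_dist_le_mul
      intro x y
      rw [Real.coe_toNNReal _ hc.le]
      exact hVlip x y
    exact this.continuous
  obtain ⟨ω, -, j, hj, hω⟩ := isCompact_Icc.tendsto_subseq
    (fun n => (abs_le.1 (hWb n) : W (n+1) 0 ∈ Icc (-R) R))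
  have hj' := hj.tendsto_atTop
  have hV0 : ∀ t, Filter.Tendsto (fun n => U (j n) t) Filter.atTop (nhds (V t)) :=
    fun t => (hV t).comp hj'
  have hV1 : ∀ t, Filter.Tendsto (fun n => U (j n + 1) t) Filter.atTop (nhds (V t)) :=
    fun t => (hV t).comp ((Filter.tendsto_add_atTop_nat 1).comp hj')
  have hpsi := psi_cont c
  have hz : ∀ n t, W (n+1) t + a * U (n+1) t = W (n+1) 0 + a * U (n+1) 0 +
      ∫ s in (0:ℝ)..t, (P s - b * sin (U n s) - k * arctan (U n s) + k * arctan (U (n+1) s)) := by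
    intro n t
    have h1 := hUc n
    have h2 := hUc (n+1)
    refine eq_integral (y := fun t => W (n+1) t + a * U (n+1) t)
      (g := fun s => P s - b * sin (U n s) - k * arctan (U n s) + k * arctan (U (n+1) s))
      (by fun_prop) (fun t => ?_) t
    refine (((hper n).2.2 t).add (((hper n).2.1 t).const_mul a)).congr_deriv ?_
    ring
  have hzlim : ∀ t, Filter.Tendsto (fun n => ∫ s in (0:ℝ)..t, (P s - b * sin (U (j n) s)
      - k * arctan (U (j n) s) + k * arctan (U (j n+1) s))) Filter.atTop
      (nhds (∫ s in (0:ℝ)..t, (P s - b * sin (V s)))) := by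
    intro t
    apply dom_conv (C := P₀ + b + k * (π / 2) + k * (π / 2))
    · intro n
      have h1 := hUc (j n)
      have h2 := hUc (j n+1)
      fun_prop
    · intro n s
      have h1 := abs_le.1 (hP s)
      have h2 := Real.sin_le_one (U (j n) s)
      have h3 := Real.neg_one_le_sin (U (j n) s)
      have h4 := abs_le.1 (arctan_abs_le (U (j n) s))
      have h5 := abs_le.1 (arctan_abs_le (U (j n+1) s))
      rw [abs_le]
      constructor <;> nlinarith
    · intro s
      have h1 := ((Real.continuous_sin.tendsto _).comp (hV0 s)).const_mul b
      have h2 := ((Real.continuous_arctan.tendsto _).comp (hV0 s)).const_mul k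
      have h3 := ((Real.continuous_arctan.tendsto _).comp (hV1 s)).const_mul k
      have h4 := ((h1.const_sub (P s)).sub h2).add h3
      rw [sub_add_cancel] at h4
      exact h4
  let Y : ℝ → ℝ := fun t => ω + a * V 0 + (∫ s in (0:ℝ)..t, (P s - b * sin (V s))) - a * V t
  have hY : ∀ t, Filter.Tendsto (fun n => W (j n + 1) t) Filter.atTop (nhds (Y t)) := by
    intro t
    have h1 := ((hω.add ((hV1 0).const_mul a)).add (hzlim t)).sub ((hV1 t).const_mul a)
    refine h1.congr fun n => ?_
    have := hz (j n) t
    simp only [Function.comp]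
    linarith
  have hgc : Continuous (fun s => P s - b * sin (V s)) := by fun_prop
  have hYz : ∀ t, HasDerivAt (fun t => Y t + a * V t) (P t - b * sin (V t)) t := by
    refine hasDeriv_integral hgc (fun t => ?_)
    simp only [Y, intervalIntegral.integral_same]
    ring
  have hYc : Continuous Y := by
    have h1 : Continuous (fun t => Y t + a * V t) :=
      continuous_iff_continuousAt.2 fun t => (hYz t).continuousAt
    have h2 : Y = fun t => (Y t + a * V t) - a * V t := by ext t; ring
    rw [h2]
    fun_prop
  have hVd : ∀ t, HasDerivAt V (psi c (Y t)) t := by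
    refine hasDeriv_integral (by fun_prop) (fun t => ?_)
    have h1 : Filter.Tendsto (fun n => U (j n + 1) 0 + ∫ s in (0:ℝ)..t, psi c (W (j n + 1) s))
        Filter.atTop (nhds (V 0 + ∫ s in (0:ℝ)..t, psi c (Y s))) := by
      apply (hV1 0).add
      apply dom_conv (C := c)
      · intro n
        have := hWc (j n + 1)
        fun_prop
      · intro n s
        exact (psi_abs_lt hc _).le
      · intro s
        exact (hpsi.tendsto _).comp (hY s)
    refine tendsto_nhds_unique (hV1 t) (h1.congr fun n => ?_)
    have := hWc (j n + 1)
    exact (eq_integral (by fun_prop) (hper (j n)).2.1 t).symm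
  refine ⟨V, Y, hVp, hVd, fun t => ?_⟩
  have h1 := (hYz t).sub ((hVd t).const_mul a)
  have h2 : Y = (fun t => Y t + a * V t) - fun t => a * V t := by ext t; simp
  rw [h2]
  refine h1.congr_deriv ?_
  simp

/-- oscillation of a periodic trajectory -/
lemma IsPer.mid {c T : ℝ} (hc : 0 < c) (hT : 0 < T) {g u w : ℝ → ℝ} (h : IsPer c T g u w) :
    ∃ m, ∀ t, |u t - m| ≤ c * T / 4 := by
  obtain ⟨x, hx, hmax⟩ := per_max hT h.cont.1 h.1
  obtain ⟨y, hy, hmin⟩ := per_max hT h.cont.1.neg (fun t => by simp only [Pi.neg_apply, h.1 t])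
  simp only [Pi.neg_apply] at hmin
  have hosc : u x - u y ≤ c * T / 2 := by
    have key : ∀ z, u z = u y → |x - z| ≤ T / 2 → u x - u y ≤ c * T / 2 := by
      intro z hz hxz
      have h1 := (abs_le.1 (h.lip hc x z)).2
      rw [hz] at h1
      nlinarith
    rcases le_or_gt |x - y| (T / 2) with h1 | h1
    · exact key y rfl h1
    · rcases lt_abs.1 h1 with h2 | h2
      · refine key (y + T) (h.1 y) (abs_le.2 ⟨?_, ?_⟩) <;> linarith [hx.1, hx.2, hy.1, hy.2]
      · refine key (y - T) (h.1.sub_eq y) (abs_le.2 ⟨?_, ?_⟩) <;>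
          linarith [hx.1, hx.2, hy.1, hy.2]
  refine ⟨(u x + u y) / 2, fun t => abs_le.2 ⟨?_, ?_⟩⟩ <;> linarith [hmax t, hmin t]

lemma IsPer.shift {c T : ℝ} {g u w : ℝ → ℝ} (h : IsPer c T g u w) (m : ℝ) :
    IsPer c T g (fun t => u t + m) w :=
  ⟨fun t => by simp only [h.1 t], fun t => (h.2.1 t).add_const m, h.2.2⟩

lemma IsPer.sol {c a b T : ℝ} (hc : 0 < c) {P u w : ℝ → ℝ} (hP : Continuous P)
    (h : IsPer c T (fun t => P t - b * sin (u t) - a * psi c (w t)) u w) :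
    IsPendSol c a b T P u := by
  have hpsi := psi_cont c
  have hd : deriv u = fun t => psi c (w t) := funext fun t => (h.2.1 t).deriv
  have hphi : (fun t => phi c (deriv u t)) = w := by
    rw [hd]; ext t; exact phi_psi hc _
  have hwd : deriv w = fun t => P t - b * sin (u t) - a * psi c (w t) :=
    funext fun t => (h.2.2 t).deriv
  obtain ⟨huc, hwc⟩ := h.cont
  refine ⟨h.1, ?_, ?_, ?_, ?_⟩
  · rw [contDiff_one_iff_deriv]
    exact ⟨fun t => (h.2.1 t).differentiableAt, by rw [hd]; fun_prop⟩
  · intro t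
    rw [hd]
    exact psi_abs_lt hc _
  · rw [hphi, contDiff_one_iff_deriv]
    exact ⟨fun t => (h.2.2 t).differentiableAt, by rw [hwd]; fun_prop⟩
  · intro t
    rw [hphi, hwd, hd]
    ring

lemma main_aux {c a b : ℝ} (hc : 0 < c) (ha : 0 < a) (hb : 0 < b) {T : ℝ} (hT : 0 < T)
    (hTs : c * T ≤ 19 / 10 * π) {p₀ : ℝ → ℝ} (hpc : Continuous p₀) (hpp : Function.Periodic p₀ T)
    (hp0 : (∫ t in (0:ℝ)..T, p₀ t) = 0) :
    Icc (-(b * cos (19 / 40 * π))) (b * cos (19 / 40 * π)) ⊆ solvSet c a b T p₀ := by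
  intro s hs
  obtain ⟨M, hM⟩ := per_bdd hT hpc hpp
  obtain ⟨u, w, hu⟩ := exists_free hc ha hT hpc hpp hM hp0
  obtain ⟨m, hm⟩ := hu.mid hc hT
  have hpi := Real.pi_pos
  have hα := hu.shift (π / 2 - m)
  have hβ := hα.shift π
  have hy : ∀ t, |u t - m| ≤ 19 / 40 * π := fun t => (hm t).trans (by linarith)
  have hsin : ∀ t, b * cos (19 / 40 * π) ≤ b * sin (u t + (π / 2 - m)) := by
    intro t
    have e : u t + (π / 2 - m) = (u t - m) + π / 2 := by ring
    rw [e, Real.sin_add_pi_div_two, ← Real.cos_abs (u t - m)]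
    gcongr
    exact Real.cos_le_cos_of_nonneg_of_le_pi (abs_nonneg _) (by linarith) (hy t)
  have hPc : Continuous (fun t => p₀ t + s) := by fun_prop
  obtain ⟨v, z, hv⟩ := exists_sol_between hc ha hb hT (P := fun t => p₀ t + s) hPc
    (fun t => by simp only [hpp t]) hα hβ
    (fun t => by linarith [(abs_le.1 (hy t)).1])
    (fun t => by linarith)
    (fun t => by linarith [(abs_le.1 (hy t)).2])
    (fun t => by linarith [hsin t, hs.2])
    (fun t => by
      rw [Real.sin_add_pi]
      linarith [hsin t, hs.1])
  exact ⟨v, hv.sol hc hPc⟩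

/-- there is `T*` with `cT* > √3 π` such that `0 ∈ I(p₀)` for all `T ≤ T*`,
and `0` is an interior point whenever `T < T*`. -/
theorem exists_Tstar (c a b : ℝ) (hc : 0 < c) (ha : 0 < a) (hb : 0 < b) :
    ∃ Tstar : ℝ, Real.sqrt 3 * Real.pi < c * Tstar ∧
      ∀ T : ℝ, 0 < T → T ≤ Tstar →
        ∀ p₀ : ℝ → ℝ, Continuous p₀ → Function.Periodic p₀ T →
          (∫ t in (0:ℝ)..T, p₀ t) = 0 →
          (0 : ℝ) ∈ solvSet c a b T p₀ ∧
          (T < Tstar → ∃ ε : ℝ, 0 < ε ∧ Set.Icc (-ε) ε ⊆ solvSet c a b T p₀) := by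
  have hpi := Real.pi_pos
  have hcos : 0 < cos (19 / 40 * π) := Real.cos_pos_of_mem_Ioo ⟨by linarith, by linarith⟩
  have hε : 0 < b * cos (19 / 40 * π) := mul_pos hb hcos
  refine ⟨19 / 10 * π / c, ?_, ?_⟩
  · rw [mul_div_cancel₀ _ hc.ne']
    have : Real.sqrt 3 < 19 / 10 := by
      rw [Real.sqrt_lt' (by norm_num)]
      norm_num
    nlinarith
  · intro T hT hTs p₀ hpc hpp hp0
    have hTs' : c * T ≤ 19 / 10 * π := by
      rw [le_div_iff₀ hc] at hTs
      linarith
    have h := main_aux hc ha hb hT hTs' hpc hpp hp0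
    exact ⟨h ⟨by linarith, hε.le⟩, fun _ => ⟨_, hε, h⟩⟩
end

section
/- If ‖p₀‖∞ < b, then setting ε = b − ‖p₀‖∞, the interval [−ε, ε] is contained in the solvability set I(p₀); that is, for every s with |s| ≤ b − ‖p₀‖∞, the equation (φ(x'(t)))' + a·x'(t) + b·sin(x(t)) = p₀(t) + s has a T-periodic solution (the constants π/2 and 3π/2 serve as lower and upper solutions). -/
open Real Set MeasureTheory

theorem glob {E : Type*} [NormedAddCommGroup E] [NormedSpace ℝ E] [CompleteSpace E]
    (f : ℝ → E → E) (K L : NNReal) (hK : ∀ t, LipschitzWith K (f t))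
    (hc : ∀ x, Continuous (fun t => f t x)) (hL : ∀ t x, ‖f t x‖ ≤ L) (z : E) :
    ∃ α : ℝ → E, α 0 = z ∧ ∀ t, HasDerivAt α (f t (α t)) t := by
  have loc : ∀ n : ℕ, ∃ α : ℝ → E, α 0 = z ∧
      ∀ t ∈ Ioo (-((n:ℝ)+1)) ((n:ℝ)+1), HasDerivAt α (f t (α t)) t := by
    intro n
    have hn : (0:ℝ) ≤ n := Nat.cast_nonneg n
    have h0 : (0:ℝ) ∈ Icc (-((n:ℝ)+1)) ((n:ℝ)+1) := ⟨by linarith, by linarith⟩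
    have hPL : IsPicardLindelof f (⟨0, h0⟩ : Icc (-((n:ℝ)+1)) ((n:ℝ)+1)) z
        (L * (n + 1)) 0 L K := by
      refine ⟨fun t _ => (hK t).lipschitzOnWith, fun x _ => (hc x).continuousOn,
        fun t _ x _ => hL t x, ?_⟩
      simp
    obtain ⟨α, h1, h2⟩ := hPL.exists_eq_forall_mem_Icc_hasDerivWithinAt₀
    exact ⟨α, h1, fun t ht => (h2 t (Ioo_subset_Icc_self ht)).hasDerivAt
      (Icc_mem_nhds ht.1 ht.2)⟩
  choose A hA0 hA using loc
  have agree : ∀ m n : ℕ, m ≤ n → EqOn (A m) (A n) (Ioo (-((m:ℝ)+1)) ((m:ℝ)+1)) := by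
    intro m n hmn
    have hm : (0:ℝ) ≤ m := Nat.cast_nonneg m
    have hmn' : (m:ℝ) ≤ n := Nat.cast_le.2 hmn
    refine ODE_solution_unique_of_mem_Ioo (v := f) (s := fun _ => univ) (K := K) (t₀ := 0)
      (fun t _ => (hK t).lipschitzOnWith) ⟨by linarith, by linarith⟩
      (fun t ht => ⟨hA m t ht, trivial⟩)
      (fun t ht => ⟨hA n t ⟨by linarith [ht.1], by linarith [ht.2]⟩, trivial⟩) ?_
    rw [hA0, hA0]
  refine ⟨fun t => A ⌈|t|⌉₊ t, by simp [hA0], fun t => ?_⟩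
  have key : ∀ s ∈ Ioo (-((⌈|t|⌉₊:ℝ)+1)) ((⌈|t|⌉₊:ℝ)+1), A ⌈|s|⌉₊ s = A ⌈|t|⌉₊ s := by
    intro s hs
    rcases le_total ⌈|s|⌉₊ ⌈|t|⌉₊ with h | h
    · refine agree _ _ h ?_
      have := abs_le.1 (Nat.le_ceil |s|)
      constructor <;> linarith [this.1, this.2]
    · exact (agree _ _ h hs).symm
  have ht : t ∈ Ioo (-((⌈|t|⌉₊:ℝ)+1)) ((⌈|t|⌉₊:ℝ)+1) := by
    have := abs_le.1 (Nat.le_ceil |t|)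
    constructor <;> linarith [this.1, this.2]
  refine (hA _ t ht).congr_of_eventuallyEq ?_
  filter_upwards [Ioo_mem_nhds ht.1 ht.2] with s hs using key s hs

theorem shoot_mono (ψ g p x₁ y₁ x₂ y₂ : ℝ → ℝ) (a T : ℝ) (ha : 0 < a) (hT : 0 < T)
    (hψm : StrictMono ψ) (hψL : ∀ u v, u ≤ v → ψ v - ψ u ≤ v - u) (hg : Monotone g)
    (hx₁ : ∀ t, HasDerivAt x₁ (ψ (y₁ t)) t)
    (hy₁ : ∀ t, HasDerivAt y₁ (p t - a * ψ (y₁ t) + g (x₁ t)) t)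
    (hx₂ : ∀ t, HasDerivAt x₂ (ψ (y₂ t)) t)
    (hy₂ : ∀ t, HasDerivAt y₂ (p t - a * ψ (y₂ t) + g (x₂ t)) t)
    (h0 : x₁ 0 = x₂ 0) (h1 : y₁ 0 < y₂ 0) : x₁ T < x₂ T := by
  have c1 : Continuous y₁ := continuous_iff_continuousAt.2 fun t => (hy₁ t).continuousAt
  have c2 : Continuous y₂ := continuous_iff_continuousAt.2 fun t => (hy₂ t).continuousAt
  have hd : ∀ t, HasDerivAt (fun t => x₂ t - x₁ t) (ψ (y₂ t) - ψ (y₁ t)) t :=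
    fun t => (hx₂ t).sub (hx₁ t)
  have dpos : ∀ τ, 0 < τ → (∀ t, 0 < t → t < τ → y₁ t < y₂ t) → x₁ τ < x₂ τ := by
    intro τ hτ h
    obtain ⟨ξ, hξ, e⟩ := exists_hasDerivAt_eq_slope (fun t => x₂ t - x₁ t) _ hτ
      (fun t _ => (hd t).continuousAt.continuousWithinAt) (fun t _ => hd t)
    have := hψm (h ξ hξ.1 hξ.2)
    rw [eq_div_iff (by linarith)] at e
    have : 0 < (ψ (y₂ ξ) - ψ (y₁ ξ)) * (τ - 0) := mul_pos (by linarith) (by linarith)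
    linarith
  have epos : ∀ t ∈ Icc 0 T, y₁ t < y₂ t := by
    by_contra! hcon
    have hcomp : IsCompact {t | t ∈ Icc 0 T ∧ y₂ t ≤ y₁ t} :=
      isCompact_Icc.inter_right (isClosed_le c2 c1)
    obtain ⟨τ, ⟨hτ, hτ2⟩, hleast⟩ := hcomp.exists_isLeast hcon
    have hτ0 : 0 < τ := by
      rcases hτ.1.lt_or_eq with h | h
      · exact h
      · rw [← h] at hτ2; linarith
    have hbef : ∀ t, 0 < t → t < τ → y₁ t < y₂ t := by
      intro t ht ht2
      by_contra! h
      have := hleast ⟨⟨ht.le, ht2.le.trans hτ.2⟩, h⟩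
      linarith
    have hw : ∀ t, HasDerivAt (fun t => (y₂ t - y₁ t) * Real.exp (a * t))
        (((p t - a * ψ (y₂ t) + g (x₂ t)) - (p t - a * ψ (y₁ t) + g (x₁ t))) * Real.exp (a * t)
          + (y₂ t - y₁ t) * (Real.exp (a * t) * (a * 1))) t := fun t =>
      ((hy₂ t).sub (hy₁ t)).mul (((hasDerivAt_id t).const_mul a).exp)
    obtain ⟨ξ, hξ, e⟩ := exists_hasDerivAt_eq_slope
      (fun t => (y₂ t - y₁ t) * Real.exp (a * t)) _ hτ0
      (fun t _ => (hw t).continuousAt.continuousWithinAt) (fun t _ => hw t)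
    rw [eq_div_iff (by linarith)] at e
    have e1 := hψL _ _ (hbef ξ hξ.1 hξ.2).le
    have e2 := hg (dpos ξ hξ.1 fun t h1 h2 => hbef t h1 (h2.trans hξ.2)).le
    have e3 : 0 ≤ (((p ξ - a * ψ (y₂ ξ) + g (x₂ ξ)) - (p ξ - a * ψ (y₁ ξ) + g (x₁ ξ)))
          * Real.exp (a * ξ) + (y₂ ξ - y₁ ξ) * (Real.exp (a * ξ) * (a * 1))) * (τ - 0) := by
      have : 0 ≤ (a * ((y₂ ξ - y₁ ξ) - (ψ (y₂ ξ) - ψ (y₁ ξ))) + (g (x₂ ξ) - g (x₁ ξ)))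
          * Real.exp (a * ξ) * τ := by
        have : 0 ≤ a * ((y₂ ξ - y₁ ξ) - (ψ (y₂ ξ) - ψ (y₁ ξ))) :=
          mul_nonneg ha.le (by linarith)
        have := Real.exp_pos (a * ξ)
        refine mul_nonneg (mul_nonneg (by linarith) this.le) hτ0.le
      linarith
    have e4 : (y₂ τ - y₁ τ) * Real.exp (a * τ) ≤ 0 :=
      mul_nonpos_of_nonpos_of_nonneg (by linarith) (Real.exp_pos _).le
    simp only [mul_zero, Real.exp_zero, mul_one] at e e3
    linarith
  exact dpos T hT fun t h1 h2 => epos t ⟨h1.le, h2.le⟩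

theorem per_exist (ψ g p : ℝ → ℝ) (a c G P T l h : ℝ) (Kg : NNReal) (ha : 0 < a) (hc : 0 < c)
    (hT : 0 < T) (hG : 0 ≤ G) (hP : 0 ≤ P)
    (hψm : StrictMono ψ) (hψ0 : ψ 0 = 0) (hψL : LipschitzWith 1 ψ) (hψb : ∀ y, |ψ y| ≤ c)
    (hg : Monotone g) (hgL : LipschitzWith Kg g) (hgb : ∀ x, |g x| ≤ G)
    (hp : Continuous p) (hpT : Function.Periodic p T) (hpb : ∀ t, |p t| ≤ P)
    (hlow : ∀ x ≤ l, ∀ t, p t + g x < 0) (hhigh : ∀ x, h ≤ x → ∀ t, 0 < p t + g x) :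
    ∃ x y : ℝ → ℝ, (∀ t, HasDerivAt x (ψ (y t)) t) ∧
      (∀ t, HasDerivAt y (p t - a * ψ (y t) + g (x t)) t) ∧
      Function.Periodic x T ∧ Function.Periodic y T := by
  have hψL' : ∀ u v, u ≤ v → ψ v - ψ u ≤ v - u := by
    intro u v huv
    have := hψL.dist_le_mul v u
    rw [Real.dist_eq, Real.dist_eq, abs_of_nonneg (by linarith : 0 ≤ v - u)] at this
    have h2 := le_abs_self (ψ v - ψ u)
    simp at this
    linarith
  obtain ⟨f, hf⟩ : ∃ f : ℝ → ℝ × ℝ → ℝ × ℝ,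
    f = fun t z => (ψ z.2, p t - a * ψ z.2 + g z.1) := ⟨_, rfl⟩
  obtain ⟨a', rfl⟩ : ∃ a' : NNReal, a = a' := ⟨⟨a, ha.le⟩, rfl⟩
  obtain ⟨L, hLd⟩ : ∃ L : NNReal, (L : ℝ) = c + P + a' * c + G :=
    ⟨⟨c + P + a' * c + G, by positivity⟩, rfl⟩
  have hfK : ∀ t, LipschitzWith (1 + a' + Kg) (f t) := by
    intro t
    refine LipschitzWith.of_dist_le_mul fun z w => ?_
    have e1 : |ψ z.2 - ψ w.2| ≤ dist z w := by
      have := hψL.dist_le_mul z.2 w.2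
      rw [Real.dist_eq] at this
      have h3 : dist z.2 w.2 ≤ dist z w := le_max_right _ _
      simp at this; linarith
    have e2 : |g z.1 - g w.1| ≤ Kg * dist z w := by
      have := hgL.dist_le_mul z.1 w.1
      rw [Real.dist_eq] at this
      have h3 : dist z.1 w.1 ≤ dist z w := le_max_left _ _
      have := mul_le_mul_of_nonneg_left h3 Kg.2
      exact le_trans (by assumption) this
    have e3 : 0 ≤ dist z w := dist_nonneg
    have e4 : 0 ≤ (a' : ℝ) * dist z w := by positivity
    have e5 : 0 ≤ (Kg : ℝ) * dist z w := by positivity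
    have e6 : |a' * (ψ z.2 - ψ w.2)| ≤ a' * dist z w := by
      rw [abs_mul, abs_of_pos ha]; exact mul_le_mul_of_nonneg_left e1 ha.le
    rw [hf, Prod.dist_eq, Real.dist_eq, Real.dist_eq]
    push_cast
    refine max_le ?_ ?_
    · nlinarith
    · have : p t - a' * ψ z.2 + g z.1 - (p t - a' * ψ w.2 + g w.1)
        = (g z.1 - g w.1) - a' * (ψ z.2 - ψ w.2) := by ring
      simp only [this]
      have := abs_sub (g z.1 - g w.1) (a' * (ψ z.2 - ψ w.2))
      nlinarith
  have hfL : ∀ t z, ‖f t z‖ ≤ L := by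
    intro t z
    have e1 := abs_le.1 (hψb z.2)
    have e2 := abs_le.1 (hpb t)
    have e3 := abs_le.1 (hgb z.1)
    have e4 : 0 ≤ (a' : ℝ) * c := by positivity
    have e5 := mul_le_mul_of_nonneg_left e1.1 ha.le
    have e6 := mul_le_mul_of_nonneg_left e1.2 ha.le
    rw [hf, Prod.norm_def, hLd, Real.norm_eq_abs, Real.norm_eq_abs]
    refine max_le (abs_le.2 ⟨?_, ?_⟩) (abs_le.2 ⟨?_, ?_⟩) <;> simp only <;> linarith
  have hfc : ∀ z, Continuous fun t => f t z := by
    intro z; rw [hf]; fun_prop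
  choose α hα0 hα using glob f _ L hfK hfc hfL
  have hX : ∀ z t, HasDerivAt (fun t => (α z t).1) (ψ (α z t).2) t := by
    intro z t; have := (hα z t).fst; rw [hf] at this; exact this
  have hY : ∀ z t, HasDerivAt (fun t => (α z t).2)
      (p t - a' * ψ (α z t).2 + g (α z t).1) t := by
    intro z t; have := (hα z t).snd; rw [hf] at this; exact this
  have hαT : Continuous fun z => α z T := by
    refine (LipschitzWith.of_dist_le_mul (K := ⟨Real.exp ((1 + a' + Kg : NNReal) * (T - 0)),
      (Real.exp_pos _).le⟩) fun z w => ?_).continuous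
    have := dist_le_of_trajectories_ODE (a := 0) (b := T) hfK
      (fun t _ => (hα z t).continuousAt.continuousWithinAt)
      (fun t _ => (hα z t).hasDerivWithinAt)
      (fun t _ => (hα w t).continuousAt.continuousWithinAt)
      (fun t _ => (hα w t).hasDerivWithinAt) le_rfl T ⟨hT.le, le_rfl⟩
    rw [hα0, hα0, mul_comm] at this
    exact this
  have bd : ∀ z, ∀ t, 0 ≤ t → t ≤ T → ‖α z t - z‖ ≤ L * T := by
    intro z t h0 h1
    have := convex_univ.norm_image_sub_le_of_norm_hasDerivWithin_le (f := α z)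
      (fun s _ => (hα z s).hasDerivWithinAt) (fun s _ => hfL s _) (mem_univ 0) (mem_univ t)
    rw [hα0, sub_zero, Real.norm_of_nonneg h0] at this
    exact this.trans (mul_le_mul_of_nonneg_left h1 L.2)
  have bd1 : ∀ z, ∀ t, 0 ≤ t → t ≤ T → |(α z t).1 - z.1| ≤ L * T := fun z t h0 h1 =>
    (norm_fst_le (α z t - z)).trans (bd z t h0 h1)
  have bd2 : ∀ z, ∀ t, 0 ≤ t → t ≤ T → |(α z t).2 - z.2| ≤ L * T := fun z t h0 h1 =>
    (norm_snd_le (α z t - z)).trans (bd z t h0 h1)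
  have mono : ∀ x y₁ y₂ : ℝ, y₁ < y₂ → (α (x, y₁) T).1 < (α (x, y₂) T).1 := by
    intro x y₁ y₂ hy
    refine shoot_mono ψ g p _ _ _ _ a' T ha hT hψm hψL' hg (hX (x, y₁)) (hY (x, y₁))
      (hX (x, y₂)) (hY (x, y₂)) ?_ ?_
    · simp [hα0]
    · simpa [hα0] using hy
  have slopeX : ∀ z, ∃ ξ, 0 < ξ ∧ ξ < T ∧ (α z T).1 - z.1 = ψ (α z ξ).2 * T := by
    intro z
    obtain ⟨ξ, hξ, e⟩ := exists_hasDerivAt_eq_slope (fun t => (α z t).1) _ hT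
      (fun t _ => (hX z t).continuousAt.continuousWithinAt) (fun t _ => hX z t)
    rw [eq_div_iff (by linarith), hα0, sub_zero] at e
    exact ⟨ξ, hξ.1, hξ.2, e.symm⟩
  have exY : ∀ x, ∃ y, (α (x, y) T).1 = x := by
    intro x
    have hLT : 0 ≤ (L:ℝ) * T := by positivity
    have hcont : Continuous fun y => (α (x, y) T).1 := by fun_prop
    have := intermediate_value_Icc (by linarith : -(L * T + 1) ≤ L * T + 1) hcont.continuousOn
    obtain ⟨y, -, hy⟩ := this (show x ∈ _ by
      constructor
      · obtain ⟨ξ, h0, h1, e⟩ := slopeX (x, -(L * T + 1))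
        have b := abs_le.1 (bd2 (x, -(L * T + 1)) ξ h0.le h1.le)
        have : ψ (α (x, -(L * T + 1)) ξ).2 < ψ 0 := hψm (by linarith [b.2])
        rw [hψ0] at this
        simp only at e
        nlinarith
      · obtain ⟨ξ, h0, h1, e⟩ := slopeX (x, (L * T + 1))
        have b := abs_le.1 (bd2 (x, (L * T + 1)) ξ h0.le h1.le)
        have : ψ 0 < ψ (α (x, (L * T + 1)) ξ).2 := hψm (by linarith [b.1])
        rw [hψ0] at this
        simp only at e
        nlinarith)
    exact ⟨y, hy⟩
  choose Y hYx using exY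
  have hYc : Continuous Y := by
    rw [continuous_iff_continuousAt]
    intro x
    have hmono : ∀ x, StrictMono fun y => (α (x, y) T).1 := fun x y₁ y₂ h => mono x y₁ y₂ h
    refine tendsto_order.2 ⟨fun v hv => ?_, fun v hv => ?_⟩
    · have h1 : (α (x, v) T).1 < x := by
        have := mono x _ _ hv; rwa [hYx] at this
      have : ∀ᶠ x' in nhds x, (α (x', v) T).1 < x' :=
        ContinuousAt.eventually_lt (by fun_prop) (by fun_prop) h1
      filter_upwards [this] with x' hx'
      refine (hmono x').lt_iff_lt.1 ?_
      simpa only [hYx] using hx'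
    · have h1 : x < (α (x, v) T).1 := by
        have := mono x _ _ hv; rwa [hYx] at this
      have : ∀ᶠ x' in nhds x, x' < (α (x', v) T).1 :=
        ContinuousAt.eventually_lt (by fun_prop) (by fun_prop) h1
      filter_upwards [this] with x' hx'
      refine (hmono x').lt_iff_lt.1 ?_
      simpa only [hYx] using hx'
  have slopeU : ∀ x, ∃ ξ, 0 < ξ ∧ ξ < T ∧
      (α (x, Y x) T).2 - Y x = (p ξ + g (α (x, Y x) ξ).1) * T := by
    intro x
    have hu : ∀ t, HasDerivAt (fun t => (α (x, Y x) t).2 + a' * (α (x, Y x) t).1)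
      (p t - a' * ψ (α (x, Y x) t).2 + g (α (x, Y x) t).1 + a' * ψ (α (x, Y x) t).2) t :=
      fun t => (hY _ t).add ((hX _ t).const_mul _)
    obtain ⟨ξ, hξ, e⟩ := exists_hasDerivAt_eq_slope
      (fun t => (α (x, Y x) t).2 + a' * (α (x, Y x) t).1) _ hT
      (fun t _ => (hu t).continuousAt.continuousWithinAt) (fun t _ => hu t)
    rw [eq_div_iff (by linarith), hα0, sub_zero, hYx] at e
    exact ⟨ξ, hξ.1, hξ.2, by linarith⟩
  have hx0 : ∃ x, (α (x, Y x) T).2 - Y x = 0 := by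
    have hcont : Continuous fun x => (α (x, Y x) T).2 - Y x := by fun_prop
    have hneg : (α (l - L * T, Y (l - L * T)) T).2 - Y (l - L * T) ≤ 0 := by
      obtain ⟨ξ, h0, h1, e⟩ := slopeU (l - L * T)
      have b := abs_le.1 (bd1 (l - L * T, Y (l - L * T)) ξ h0.le h1.le)
      have := hlow (α (l - L * T, Y (l - L * T)) ξ).1 (by linarith [b.2]) ξ
      rw [e]; nlinarith
    have hpos : 0 ≤ (α (h + L * T, Y (h + L * T)) T).2 - Y (h + L * T) := by
      obtain ⟨ξ, h0, h1, e⟩ := slopeU (h + L * T)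
      have b := abs_le.1 (bd1 (h + L * T, Y (h + L * T)) ξ h0.le h1.le)
      have := hhigh (α (h + L * T, Y (h + L * T)) ξ).1 (by linarith [b.1]) ξ
      rw [e]; nlinarith
    exact mem_range_of_exists_le_of_exists_ge hcont ⟨_, hneg⟩ ⟨_, hpos⟩
  obtain ⟨x, hx⟩ := hx0
  have hper : (fun t => α (x, Y x) (t + T)) = α (x, Y x) := by
    refine ODE_solution_unique_univ (v := f) (s := fun _ => univ) (t₀ := 0)
      (fun t => (hfK t).lipschitzOnWith) (fun t => ⟨?_, trivial⟩) (fun t => ⟨hα _ t, trivial⟩) ?_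
    · have h1 := (hα (x, Y x) (t + T)).comp_add_const t T
      have h2 : f (t + T) = f t := by rw [hf]; simp only [hpT t]
      rw [h2] at h1
      exact h1
    · simp only [zero_add]
      rw [hα0]
      exact Prod.ext (hYx x) (by simp only; linarith)
  refine ⟨fun t => (α (x, Y x) t).1, fun t => (α (x, Y x) t).2, hX _, hY _, ?_, ?_⟩
  · intro t; exact congrArg Prod.fst (congrFun hper t)
  · intro t; exact congrArg Prod.snd (congrFun hper t)

theorem no_max (ψ x y : ℝ → ℝ) (t₀ d : ℝ) (hψm : StrictMono ψ) (hψ0 : ψ 0 = 0)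
    (hx : ∀ t, HasDerivAt x (ψ (y t)) t) (hy : HasDerivAt y d t₀)
    (hmax : ∀ t, x t ≤ x t₀) (hd : y t₀ = 0 → 0 < d) : False := by
  have h0 : ψ (y t₀) = 0 :=
    IsLocalMax.hasDerivAt_eq_zero (Filter.Eventually.of_forall hmax) (hx t₀)
  have hy0 : y t₀ = 0 := hψm.injective (h0.trans hψ0.symm)
  have hev := (hasDerivAt_iff_tendsto_slope.1 hy).eventually (lt_mem_nhds (hd hy0))
  have hev2 := hev.filter_mono (nhdsWithin_mono t₀ (fun s hs => ne_of_gt hs : Ioi t₀ ⊆ {t₀}ᶜ))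
  obtain ⟨u, hu, hsub⟩ := mem_nhdsGT_iff_exists_Ioo_subset.1 hev2
  obtain ⟨ξ, hξ, e⟩ := exists_hasDerivAt_eq_slope x _ hu
    (fun t _ => (hx t).continuousAt.continuousWithinAt) (fun t _ => hx t)
  have hs : 0 < slope y t₀ ξ := hsub hξ
  rw [slope_def_field, hy0, sub_zero] at hs
  have hyξ : 0 < y ξ := by
    have := mul_pos hs (sub_pos.2 hξ.1)
    rwa [div_mul_cancel₀ _ (sub_pos.2 hξ.1).ne'] at this
  have h3 := hψm hyξ
  rw [hψ0, e] at h3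
  have h4 : 0 < u - t₀ := sub_pos.2 hu
  have := mul_pos h3 h4
  rw [div_mul_cancel₀ _ h4.ne'] at this
  linarith [hmax u]

theorem psi_deriv (c : ℝ) (hc : 0 < c) (y : ℝ) :
    HasDerivAt (fun y => y / Real.sqrt (1 + y ^ 2 / c ^ 2))
      (1 / (Real.sqrt (1 + y ^ 2 / c ^ 2)) ^ 3) y := by
  have hq : 0 < 1 + y ^ 2 / c ^ 2 := by positivity
  have h1 : HasDerivAt (fun y : ℝ => 1 + y ^ 2 / c ^ 2) (2 * y / c ^ 2) y := by
    have := ((hasDerivAt_pow 2 y).div_const (c ^ 2)).const_add 1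
    simpa using this
  have h2 := (hasDerivAt_id y).div (h1.sqrt hq.ne') (Real.sqrt_pos.2 hq).ne'
  refine h2.congr_deriv ?_
  have hs : Real.sqrt (1 + y ^ 2 / c ^ 2) ^ 2 = 1 + y ^ 2 / c ^ 2 := Real.sq_sqrt hq.le
  have hs0 := Real.sqrt_pos.2 hq
  set s := Real.sqrt (1 + y ^ 2 / c ^ 2)
  have hs' : c ^ 2 * s ^ 2 = c ^ 2 + y ^ 2 := by rw [hs]; field_simp
  simp only [id]
  field_simp
  linarith

theorem psi_props (c : ℝ) (hc : 0 < c) : ∃ ψ : ℝ → ℝ, StrictMono ψ ∧ ψ 0 = 0 ∧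
    LipschitzWith 1 ψ ∧ (∀ y, |ψ y| < c) ∧ ∀ y, phi c (ψ y) = y := by
  have hq : ∀ y : ℝ, 0 < 1 + y ^ 2 / c ^ 2 := fun y => by positivity
  refine ⟨fun y => y / Real.sqrt (1 + y ^ 2 / c ^ 2), ?_, by simp, ?_, ?_, ?_⟩
  · refine strictMono_of_hasDerivAt_pos (psi_deriv c hc) fun y => ?_
    have := Real.sqrt_pos.2 (hq y)
    positivity
  · refine lipschitzWith_of_nnnorm_deriv_le (fun y => (psi_deriv c hc y).differentiableAt) ?_
    intro y
    rw [(psi_deriv c hc y).deriv, ← NNReal.coe_le_coe, coe_nnnorm]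
    have h1 : 1 ≤ Real.sqrt (1 + y ^ 2 / c ^ 2) := by
      rw [Real.one_le_sqrt]
      have : 0 ≤ y ^ 2 / c ^ 2 := by positivity
      linarith
    rw [Real.norm_of_nonneg (by positivity)]
    rw [NNReal.coe_one, div_le_one (by positivity)]
    exact one_le_pow₀ h1
  · intro y
    have h0 := Real.sqrt_pos.2 (hq y)
    simp only
    rw [abs_div, abs_of_pos h0, div_lt_iff₀ h0]
    refine abs_lt_of_sq_lt_sq ?_ (by positivity)
    rw [mul_pow, Real.sq_sqrt (hq y).le]
    field_simp
    nlinarith [sq_nonneg y, pow_pos hc 2]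
  · intro y
    have h0 := Real.sqrt_pos.2 (hq y)
    have hs : Real.sqrt (1 + y ^ 2 / c ^ 2) ^ 2 = 1 + y ^ 2 / c ^ 2 := Real.sq_sqrt (hq y).le
    unfold phi
    simp only
    have : 1 - (y / Real.sqrt (1 + y ^ 2 / c ^ 2)) ^ 2 / c ^ 2
        = (1 / Real.sqrt (1 + y ^ 2 / c ^ 2)) ^ 2 := by
      have := hq y
      rw [div_pow, div_pow, hs]
      have h5 : c ^ 2 + y ^ 2 ≠ 0 := by positivity
      field_simp
      ring
    rw [this, Real.sqrt_sq (by positivity)]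
    field_simp

theorem g_props (b : ℝ) (hb : 0 < b) : ∃ g : ℝ → ℝ, Monotone g ∧ (∃ K, LipschitzWith K g) ∧
    (∀ x, |g x| ≤ b + 2) ∧ (∀ x, π / 2 ≤ x → x ≤ 3 * π / 2 → g x = - (b * Real.sin x)) ∧
    (∀ x, 3 * π / 2 < x → b < g x) ∧ (∀ x, x < π / 2 → g x < -b) := by
  have hpi := Real.pi_pos
  let C : ℝ → ℝ := fun x => max (π / 2) (min x (3 * π / 2))
  have hCm : Monotone C := fun x y h => max_le_max le_rfl (min_le_min h le_rfl)
  have hC1 : ∀ x, π / 2 ≤ C x := fun x => le_max_left _ _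
  have hC2 : ∀ x, C x ≤ 3 * π / 2 := fun x => max_le (by linarith) (min_le_right _ _)
  have hCL : LipschitzWith 1 C := (LipschitzWith.id.min_const _).const_max _
  have s1 : Real.sin (π / 2) = 1 := Real.sin_pi_div_two
  have s2 : Real.sin (3 * π / 2) = -1 := by
    rw [show 3 * π / 2 = π / 2 + π by ring, Real.sin_add_pi, s1]
  have hsL : LipschitzWith 1 Real.sin := by
    refine lipschitzWith_of_nnnorm_deriv_le Real.differentiable_sin fun x => ?_
    rw [Real.deriv_sin, ← NNReal.coe_le_coe, coe_nnnorm]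
    exact Real.abs_cos_le_one x
  have hb1 : ∀ x : ℝ, -1 ≤ max (-1) (min (x - π / 2) 0) ∧ max (-1) (min (x - π / 2) 0) ≤ 0 :=
    fun x => ⟨le_max_left _ _, max_le (by norm_num) (min_le_right _ _)⟩
  have hb2 : ∀ x : ℝ, 0 ≤ min 1 (max (x - 3 * π / 2) 0) ∧ min 1 (max (x - 3 * π / 2) 0) ≤ 1 :=
    fun x => ⟨le_min (by norm_num) (le_max_right _ _), min_le_left _ _⟩
  refine ⟨fun x => -(b * Real.sin (C x)) + max (-1) (min (x - π / 2) 0)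
    + min 1 (max (x - 3 * π / 2) 0), ?_, ?_, ?_, ?_, ?_, ?_⟩
  · intro x y hxy
    have hs : Real.sin (C y) ≤ Real.sin (C x) := by
      have := Real.strictMonoOn_sin.monotoneOn
        (show π - C y ∈ Icc (-(π / 2)) (π / 2) from ⟨by linarith [hC2 y], by linarith [hC1 y]⟩)
        (show π - C x ∈ Icc (-(π / 2)) (π / 2) from ⟨by linarith [hC2 x], by linarith [hC1 x]⟩)
        (by linarith [hCm hxy])
      simpa [Real.sin_pi_sub] using this
    have h1 := mul_le_mul_of_nonneg_left hs hb.le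
    have h2 : max (-1) (min (x - π / 2) 0) ≤ max (-1) (min (y - π / 2) 0) := by gcongr
    have h3 : min 1 (max (x - 3 * π / 2) 0) ≤ min 1 (max (y - 3 * π / 2) 0) := by gcongr
    simp only
    linarith
  · have l1 : LipschitzWith ⟨b, hb.le⟩ fun u : ℝ => -(b * Real.sin u) := by
      refine LipschitzWith.of_dist_le_mul fun u v => ?_
      have h := hsL.dist_le_mul u v
      rw [Real.dist_eq] at h ⊢
      rw [show -(b * Real.sin u) - -(b * Real.sin v) = -(b * (Real.sin u - Real.sin v)) by ring,
        abs_neg, abs_mul, abs_of_pos hb]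
      have h' : |Real.sin u - Real.sin v| ≤ dist u v := by simpa using h
      exact mul_le_mul_of_nonneg_left h' hb.le
    have l2 := (((LipschitzWith.id (α := ℝ)).sub
      (LipschitzWith.const (π / 2))).min_const 0).const_max (-1)
    have l3 := (((LipschitzWith.id (α := ℝ)).sub
      (LipschitzWith.const (3 * π / 2))).max_const 0).const_min 1
    exact ⟨_, ((l1.comp hCL).add l2).add l3⟩
  · intro x
    have h1 := hb1 x
    have h2 := hb2 x
    have h3 := mul_le_mul_of_nonneg_left (Real.sin_le_one (C x)) hb.le
    have h4 := mul_le_mul_of_nonneg_left (Real.neg_one_le_sin (C x)) hb.le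
    rw [abs_le]
    simp only
    constructor <;> linarith [h1.1, h1.2, h2.1, h2.2]
  · intro x h1 h2
    have e1 : C x = x := by
      simp only [C]; rw [min_eq_left h2, max_eq_right h1]
    simp only [e1]
    rw [min_eq_right (by linarith), max_eq_right (by norm_num), max_eq_right (by linarith),
      min_eq_right (by norm_num)]
    ring
  · intro x h1
    have e1 : C x = 3 * π / 2 := by
      simp only [C]; rw [min_eq_right h1.le, max_eq_right (by linarith)]
    simp only [e1, s2]
    rw [min_eq_right (by linarith), max_eq_right (by norm_num)]
    have : 0 < min 1 (max (x - 3 * π / 2) 0) :=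
      lt_min one_pos (lt_max_of_lt_left (by linarith))
    linarith
  · intro x h1
    have e1 : C x = π / 2 := by
      simp only [C]; rw [min_eq_left (by linarith), max_eq_left h1.le]
    simp only [e1, s1]
    rw [max_eq_right (by linarith : x - 3 * π / 2 ≤ 0), min_eq_right zero_le_one]
    have : max (-1) (min (x - π / 2) 0) < 0 :=
      max_lt (by norm_num) (min_lt_of_left_lt (by linarith))
    linarith

/-- if `‖p₀‖∞ < b` then `[-(b - ‖p₀‖∞), b - ‖p₀‖∞] ⊆ I(p₀)`; formulated for
any uniform bound `M < b` of `p₀`. -/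
theorem solvSet_of_small_forcing (c a b T : ℝ) (hc : 0 < c) (ha : 0 < a) (hb : 0 < b)
    (hT : 0 < T) (p₀ : ℝ → ℝ) (hp₀cont : Continuous p₀) (hp₀per : Function.Periodic p₀ T)
    (hp₀avg : (∫ t in (0:ℝ)..T, p₀ t) = 0)
    (M : ℝ) (hM : ∀ t : ℝ, |p₀ t| ≤ M) (hMb : M < b) :
    Set.Icc (-(b - M)) (b - M) ⊆ solvSet c a b T p₀ := by
  intro s hs
  obtain ⟨ψ, hψm, hψ0, hψL, hψb, hφ⟩ := psi_props c hc
  obtain ⟨g, hgm, ⟨K, hgL⟩, hgb, hgin, hghi, hglo⟩ := g_props b hb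
  have hp : ∀ t, -b ≤ p₀ t + s ∧ p₀ t + s ≤ b := fun t => by
    have := abs_le.1 (hM t)
    constructor <;> linarith [hs.1, hs.2, this.1, this.2]
  obtain ⟨x, y, hx, hy, hxT, hyT⟩ := per_exist ψ g (fun t => p₀ t + s) a c (b + 2) b T
    (π / 2 - 1) (3 * π / 2 + 1) K ha hc hT (by linarith) hb.le hψm hψ0 hψL
    (fun y => (hψb y).le) hgm hgL hgb (by fun_prop) (fun t => by simp only [hp₀per t])
    (fun t => abs_le.2 (hp t)) (fun x hx t => by linarith [hglo x (by linarith), (hp t).2])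
    (fun x hx t => by linarith [hghi x (by linarith), (hp t).1])
  have xc : Continuous x := continuous_iff_continuousAt.2 fun t => (hx t).continuousAt
  have yc : Continuous y := continuous_iff_continuousAt.2 fun t => (hy t).continuousAt
  have hcomp : IsCompact (range x) := hxT.compact_of_continuous hT.ne' xc
  have hup : ∀ t, x t ≤ 3 * π / 2 := by
    obtain ⟨_, ⟨t₀, rfl⟩, hmax⟩ := hcomp.exists_isGreatest (range_nonempty x)
    have hmax' : ∀ t, x t ≤ x t₀ := fun t => hmax ⟨t, rfl⟩
    by_contra! hcon
    obtain ⟨t, ht⟩ := hcon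
    refine no_max ψ x y t₀ _ hψm hψ0 hx (hy t₀) hmax' fun h => ?_
    rw [h, hψ0]
    linarith [hghi (x t₀) (ht.trans_le (hmax' t)), (hp t₀).1]
  have hlo : ∀ t, π / 2 ≤ x t := by
    obtain ⟨_, ⟨t₀, rfl⟩, hmin⟩ := hcomp.exists_isLeast (range_nonempty x)
    have hmin' : ∀ t, x t₀ ≤ x t := fun t => hmin ⟨t, rfl⟩
    by_contra! hcon
    obtain ⟨t, ht⟩ := hcon
    refine no_max (fun v => -ψ (-v)) (fun t => -x t) (fun t => -y t) t₀ _
      (fun u v h => neg_lt_neg (hψm (neg_lt_neg h))) (by simp [hψ0])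
      (fun t => by simp only [neg_neg]; exact (hx t).neg) (hy t₀).neg (fun t => neg_le_neg (hmin' t)) fun h => ?_
    have h' : y t₀ = 0 := by simpa using h
    rw [h', hψ0]
    linarith [hglo (x t₀) ((hmin' t).trans_lt ht), (hp t₀).2]
  have hdx : deriv x = fun t => ψ (y t) := funext fun t => (hx t).deriv
  have hφy : (fun t => phi c (deriv x t)) = y := by
    funext t; rw [hdx]; exact hφ _
  have hdy : deriv y = fun t => p₀ t + s - a * ψ (y t) + g (x t) := funext fun t => (hy t).deriv
  refine ⟨x, hxT, ?_, ?_, ?_, ?_⟩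
  · rw [contDiff_one_iff_deriv, hdx]
    exact ⟨fun t => (hx t).differentiableAt, hψL.continuous.comp yc⟩
  · intro t; rw [hdx]; exact hψb _
  · rw [hφy, contDiff_one_iff_deriv, hdy]
    refine ⟨fun t => (hy t).differentiableAt, ?_⟩
    have h1 := hψL.continuous.comp yc
    have h2 := hgL.continuous.comp xc
    exact ((hp₀cont.add continuous_const).sub (continuous_const.mul h1)).add h2
  · intro t
    rw [hφy, hdy, hdx]
    simp only
    rw [hgin _ (hlo t) (hup t)]
    ring
end
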